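/- For every z in the upper half-plane ℍ: Φ12(x1(z),…,x6(z)) = Δ(z). -/

import Mathlib

open Complex Finset

noncomputable section

/-- `ζ = exp(2πi/13)`. -/
def zeta13 : ℂ := Complex.exp (2 * Real.pi * Complex.I / 13)

local notation "ζ" => zeta13

/-- The diagonal matrix `T = diag(ζ^7, ζ^11, ζ^8, ζ^6, ζ^2, ζ^5)`. -/
def Tmat : Matrix (Fin 6) (Fin 6) ℂ :=
  Matrix.diagonal ![ζ ^ 7, ζ ^ 11, ζ ^ 8, ζ ^ 6, ζ ^ 2, ζ ^ 5]

/-- The matrix `S = -(1/√13)·M`. -/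
def Smat : Matrix (Fin 6) (Fin 6) ℂ :=
  (-(1 / (Real.sqrt 13 : ℂ))) • Matrix.of
    ![![ζ^12 - ζ, ζ^10 - ζ^3, ζ^4 - ζ^9, ζ^5 - ζ^8, ζ^2 - ζ^11, ζ^6 - ζ^7],
      ![ζ^10 - ζ^3, ζ^4 - ζ^9, ζ^12 - ζ, ζ^2 - ζ^11, ζ^6 - ζ^7, ζ^5 - ζ^8],
      ![ζ^4 - ζ^9, ζ^12 - ζ, ζ^10 - ζ^3, ζ^6 - ζ^7, ζ^5 - ζ^8, ζ^2 - ζ^11],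
      ![ζ^5 - ζ^8, ζ^2 - ζ^11, ζ^6 - ζ^7, ζ - ζ^12, ζ^3 - ζ^10, ζ^9 - ζ^4],
      ![ζ^2 - ζ^11, ζ^6 - ζ^7, ζ^5 - ζ^8, ζ^3 - ζ^10, ζ^9 - ζ^4, ζ - ζ^12],
      ![ζ^6 - ζ^7, ζ^5 - ζ^8, ζ^2 - ζ^11, ζ^9 - ζ^4, ζ - ζ^12, ζ^3 - ζ^10]]

/-- The matrix `H`, mapping `(z1,…,z6)` to `(z6, z4, z5, −z3, −z1, −z2)`. -/
def Hmat : Matrix (Fin 6) (Fin 6) ℂ :=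
  Matrix.of
    ![![0,0,0,0,0,1], ![0,0,0,1,0,0], ![0,0,0,0,1,0],
      ![0,0,-1,0,0,0], ![-1,0,0,0,0,0], ![0,-1,0,0,0,0]]

/-- The senary quadratic forms `A_0, …, A_6` (here `v 0 = z1, …, v 5 = z6`). -/
def A : ℕ → (Fin 6 → ℂ) → ℂ
  | 0, v => v 0 * v 3 + v 1 * v 4 + v 2 * v 5
  | 1, v => v 0 ^ 2 - 2 * v 2 * v 3
  | 2, v => -v 4 ^ 2 - 2 * v 1 * v 3
  | 3, v => v 1 ^ 2 - 2 * v 0 * v 4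
  | 4, v => v 2 ^ 2 - 2 * v 1 * v 5
  | 5, v => -v 3 ^ 2 - 2 * v 0 * v 5
  | 6, v => -v 5 ^ 2 - 2 * v 2 * v 4
  | _, _ => 0

/-- `w_ν = (A0 + ζ^ν A1 + ζ^{4ν} A2 + ζ^{9ν} A3 + ζ^{3ν} A4 + ζ^{12ν} A5 + ζ^{10ν} A6)^2`. -/
def w (ν : ℕ) (v : Fin 6 → ℂ) : ℂ :=
  (A 0 v + ζ ^ ν * A 1 v + ζ ^ (4 * ν) * A 2 v + ζ ^ (9 * ν) * A 3 v +
    ζ ^ (3 * ν) * A 4 v + ζ ^ (12 * ν) * A 5 v + ζ ^ (10 * ν) * A 6 v) ^ 2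

/-- `w_∞ = 13·A0^2`. -/
def winf (v : Fin 6 → ℂ) : ℂ := 13 * A 0 v ^ 2

/-- The senary cubic forms `D_0, …, D_12` (here `v 0 = z1, …, v 5 = z6`). -/
def D : ℕ → (Fin 6 → ℂ) → ℂ
  | 0, v => v 0 * v 1 * v 2
  | 1, v => 2 * v 1 * v 2 ^ 2 + v 1 ^ 2 * v 5 - v 3 ^ 2 * v 4 + v 0 * v 4 * v 5
  | 2, v => -v 5 ^ 3 + v 1 ^ 2 * v 3 - 2 * v 1 * v 4 ^ 2 + v 0 * v 3 * v 4 + 3 * v 2 * v 4 * v 5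
  | 3, v => 2 * v 0 * v 1 ^ 2 + v 0 ^ 2 * v 4 - v 3 * v 5 ^ 2 + v 2 * v 3 * v 4
  | 4, v => -v 1 ^ 2 * v 2 + v 0 * v 5 ^ 2 - 2 * v 3 ^ 2 * v 5 - v 0 * v 2 * v 4
  | 5, v => -v 3 ^ 3 + v 2 ^ 2 * v 4 - 2 * v 2 * v 5 ^ 2 + v 1 * v 4 * v 5 + 3 * v 0 * v 3 * v 5
  | 6, v => -v 4 ^ 3 + v 0 ^ 2 * v 5 - 2 * v 0 * v 3 ^ 2 + v 2 * v 3 * v 5 + 3 * v 1 * v 3 * v 4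
  | 7, v => -v 1 ^ 3 + v 2 * v 3 ^ 2 - v 0 * v 2 * v 5 - 3 * v 0 * v 1 * v 4 + 2 * v 0 ^ 2 * v 3
  | 8, v => -v 0 ^ 3 + v 1 * v 5 ^ 2 - v 1 * v 2 * v 4 - 3 * v 0 * v 2 * v 3 + 2 * v 2 ^ 2 * v 5
  | 9, v => 2 * v 0 ^ 2 * v 2 + v 2 ^ 2 * v 3 - v 4 ^ 2 * v 5 + v 1 * v 3 * v 5
  | 10, v => -v 0 * v 2 ^ 2 + v 1 * v 3 ^ 2 - 2 * v 3 * v 4 ^ 2 - v 0 * v 1 * v 5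
  | 11, v => -v 2 ^ 3 + v 0 * v 4 ^ 2 - v 0 * v 1 * v 3 - 3 * v 1 * v 2 * v 5 + 2 * v 1 ^ 2 * v 4
  | 12, v => -v 0 ^ 2 * v 1 + v 2 * v 4 ^ 2 - 2 * v 4 * v 5 ^ 2 - v 1 * v 2 * v 3
  | _, _ => 0

/-- The senary cubic form `D_∞ = z4 z5 z6`. -/
def Dinf (v : Fin 6 → ℂ) : ℂ := v 3 * v 4 * v 5

/-- The senary sextic forms `G_0, …, G_12`. -/
def Gs : ℕ → (Fin 6 → ℂ) → ℂ
  | 0, v => D 0 v ^ 2 + Dinf v ^ 2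
  | 1, v => -D 7 v ^ 2 + 2 * D 0 v * D 1 v + 10 * Dinf v * D 1 v + 2 * D 2 v * D 12 v
      - 2 * D 3 v * D 11 v - 4 * D 4 v * D 10 v - 2 * D 9 v * D 5 v
  | 2, v => -2 * D 1 v ^ 2 - 4 * D 0 v * D 2 v + 6 * Dinf v * D 2 v - 2 * D 4 v * D 11 v
      + 2 * D 5 v * D 10 v - 2 * D 6 v * D 9 v - 2 * D 7 v * D 8 v
  | 3, v => -D 8 v ^ 2 + 2 * D 0 v * D 3 v + 10 * Dinf v * D 3 v + 2 * D 6 v * D 10 v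
      - 2 * D 9 v * D 7 v - 4 * D 12 v * D 4 v - 2 * D 1 v * D 2 v
  | 4, v => -D 2 v ^ 2 + 10 * D 0 v * D 4 v - 2 * Dinf v * D 4 v + 2 * D 5 v * D 12 v
      - 2 * D 9 v * D 8 v - 4 * D 1 v * D 3 v - 2 * D 10 v * D 7 v
  | 5, v => -2 * D 9 v ^ 2 - 4 * D 0 v * D 5 v + 6 * Dinf v * D 5 v - 2 * D 10 v * D 8 v
      + 2 * D 6 v * D 12 v - 2 * D 2 v * D 3 v - 2 * D 11 v * D 7 v
  | 6, v => -2 * D 3 v ^ 2 - 4 * D 0 v * D 6 v + 6 * Dinf v * D 6 v - 2 * D 12 v * D 7 v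
      + 2 * D 2 v * D 4 v - 2 * D 5 v * D 1 v - 2 * D 8 v * D 11 v
  | 7, v => -2 * D 10 v ^ 2 + 6 * D 0 v * D 7 v + 4 * Dinf v * D 7 v - 2 * D 1 v * D 6 v
      - 2 * D 2 v * D 5 v - 2 * D 8 v * D 12 v - 2 * D 9 v * D 11 v
  | 8, v => -2 * D 4 v ^ 2 + 6 * D 0 v * D 8 v + 4 * Dinf v * D 8 v - 2 * D 3 v * D 5 v
      - 2 * D 6 v * D 2 v - 2 * D 11 v * D 10 v - 2 * D 1 v * D 7 v
  | 9, v => -D 11 v ^ 2 + 2 * D 0 v * D 9 v + 10 * Dinf v * D 9 v + 2 * D 5 v * D 4 v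
      - 2 * D 1 v * D 8 v - 4 * D 10 v * D 12 v - 2 * D 3 v * D 6 v
  | 10, v => -D 5 v ^ 2 + 10 * D 0 v * D 10 v - 2 * Dinf v * D 10 v + 2 * D 6 v * D 4 v
      - 2 * D 3 v * D 7 v - 4 * D 9 v * D 1 v - 2 * D 12 v * D 11 v
  | 11, v => -2 * D 12 v ^ 2 + 6 * D 0 v * D 11 v + 4 * Dinf v * D 11 v - 2 * D 9 v * D 2 v
      - 2 * D 5 v * D 6 v - 2 * D 7 v * D 4 v - 2 * D 3 v * D 8 v
  | 12, v => -D 6 v ^ 2 + 10 * D 0 v * D 12 v - 2 * Dinf v * D 12 v + 2 * D 2 v * D 10 v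
      - 2 * D 1 v * D 11 v - 4 * D 3 v * D 9 v - 2 * D 4 v * D 8 v
  | _, _ => 0

/-- `δ_ν = −13·G0 + Σ_{j=1}^{12} ζ^{jν} G_j`. -/
def deltaF (ν : ℕ) (v : Fin 6 → ℂ) : ℂ :=
  -13 * Gs 0 v + ∑ j ∈ Finset.Icc 1 12, ζ ^ (j * ν) * Gs j v

/-- `δ_∞ = 13^2·G0`. -/
def deltaInf (v : Fin 6 → ℂ) : ℂ := 13 ^ 2 * Gs 0 v

/-- `Φ4 = Σ_ν w_ν + w_∞`. -/
def Phi4 (v : Fin 6 → ℂ) : ℂ := (∑ ν ∈ Finset.range 13, w ν v) + winf v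

/-- `Φ8 = Σ_ν w_ν^2 + w_∞^2`. -/
def Phi8 (v : Fin 6 → ℂ) : ℂ := (∑ ν ∈ Finset.range 13, w ν v ^ 2) + winf v ^ 2

/-- `Φ12′ = −(1/(13·30))(Σ_ν w_ν^3 + w_∞^3)`. -/
def Phi12' (v : Fin 6 → ℂ) : ℂ :=
  -(1 / (13 * 30)) * ((∑ ν ∈ Finset.range 13, w ν v ^ 3) + winf v ^ 3)

/-- `Φ16 = Σ_ν w_ν^4 + w_∞^4`. -/
def Phi16 (v : Fin 6 → ℂ) : ℂ := (∑ ν ∈ Finset.range 13, w ν v ^ 4) + winf v ^ 4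

/-- `Φ20 = (1/(13·25))(Σ_ν w_ν^5 + w_∞^5)`. -/
def Phi20 (v : Fin 6 → ℂ) : ℂ :=
  (1 / (13 * 25)) * ((∑ ν ∈ Finset.range 13, w ν v ^ 5) + winf v ^ 5)

/-- `Φ12 = −(1/(13·52))(Σ_ν δ_ν^2 + δ_∞^2)`. -/
def Phi12 (v : Fin 6 → ℂ) : ℂ :=
  -(1 / (13 * 52)) * ((∑ ν ∈ Finset.range 13, deltaF ν v ^ 2) + deltaInf v ^ 2)

/-- `Φ18 = (1/(13·6))(Σ_ν δ_ν^3 + δ_∞^3)`. -/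
def Phi18 (v : Fin 6 → ℂ) : ℂ :=
  (1 / (13 * 6)) * ((∑ ν ∈ Finset.range 13, deltaF ν v ^ 3) + deltaInf v ^ 3)

/-- `Φ30 = −(1/(13·1315))(Σ_ν δ_ν^5 + δ_∞^5)`. -/
def Phi30 (v : Fin 6 → ℂ) : ℂ :=
  -(1 / (13 * 1315)) * ((∑ ν ∈ Finset.range 13, deltaF ν v ^ 5) + deltaInf v ^ 5)

/-- `q^α = exp(2πiαz)`. -/
def qp (α : ℚ) (z : ℂ) : ℂ := Complex.exp (2 * Real.pi * Complex.I * (α : ℂ) * z)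

/-- `Σ_{n∈ℤ} (−1)^n q^{(13n^2+cn)/2}`. -/
def thetaSum (c : ℤ) (z : ℂ) : ℂ :=
  ∑' n : ℤ, (-1 : ℂ) ^ n * qp ((13 * (n : ℚ) ^ 2 + (c : ℚ) * (n : ℚ)) / 2) z

/-- The theta constants of order 13: `a_1, …, a_6`. -/
def thc : ℕ → ℂ → ℂ
  | 1, z => qp (121 / 104) z * thetaSum 11 z
  | 2, z => qp (49 / 104) z * thetaSum 7 z
  | 3, z => qp (25 / 104) z * thetaSum 5 z
  | 4, z => -(qp (9 / 104) z * thetaSum 3 z)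
  | 5, z => qp (81 / 104) z * thetaSum 9 z
  | 6, z => qp (1 / 104) z * thetaSum 1 z
  | _, _ => 0

/-- The vector `A(z) = (a1(z), …, a6(z))`. -/
def Avec (z : ℂ) : Fin 6 → ℂ := fun i => thc (i.val + 1) z

/-- The Dedekind eta function `η(z) = q^{1/24} Π_{n=1}^∞ (1−q^n)`. -/
def etaF (z : ℂ) : ℂ :=
  qp (1 / 24) z * ∏' n : ℕ, (1 - Complex.exp (2 * Real.pi * Complex.I * z) ^ (n + 1))

/-- The vector `(x1(z), …, x6(z))` with `x_i(z) = η(z)·a_i(z)`. -/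
def X (z : ℂ) : Fin 6 → ℂ := fun i => etaF z * thc (i.val + 1) z

/-- The discriminant `Δ(z) = η(z)^24`. -/
def Delta (z : ℂ) : ℂ := etaF z ^ 24

/-- The Eisenstein series `E4(z) = (1/2) Σ_{gcd(m,n)=1} (mz+n)^{−4}`. -/
def E4 (z : ℂ) : ℂ :=
  (1 / 2) * ∑' p : {p : ℤ × ℤ // Int.gcd p.1 p.2 = 1},
    ((p.1.1 : ℂ) * z + (p.1.2 : ℂ)) ^ (-4 : ℤ)

/-- The Eisenstein series `E6(z) = (1/2) Σ_{gcd(m,n)=1} (mz+n)^{−6}`. -/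
def E6 (z : ℂ) : ℂ :=
  (1 / 2) * ∑' p : {p : ℤ × ℤ // Int.gcd p.1 p.2 = 1},
    ((p.1.1 : ℂ) * z + (p.1.2 : ℂ)) ^ (-6 : ℤ)

/-- The matrix with entries `e ^ (-x * y) - e ^ (x * y)`, for `x, y` running through
the representatives `1, 3, 9, 8, 11, 7` of the nonzero residues modulo `13` up to sign. -/
def sineTransform (e : ℂ) (v : Fin 6 → ℂ) : Fin 6 → ℂ :=
  ![(e ^ 12 - e) * v 0 + (e ^ 10 - e ^ 3) * v 1 + (e ^ 4 - e ^ 9) * v 2 +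
      (e ^ 5 - e ^ 8) * v 3 + (e ^ 2 - e ^ 11) * v 4 + (e ^ 6 - e ^ 7) * v 5,
    (e ^ 10 - e ^ 3) * v 0 + (e ^ 4 - e ^ 9) * v 1 + (e ^ 12 - e) * v 2 +
      (e ^ 2 - e ^ 11) * v 3 + (e ^ 6 - e ^ 7) * v 4 + (e ^ 5 - e ^ 8) * v 5,
    (e ^ 4 - e ^ 9) * v 0 + (e ^ 12 - e) * v 1 + (e ^ 10 - e ^ 3) * v 2 +
      (e ^ 6 - e ^ 7) * v 3 + (e ^ 5 - e ^ 8) * v 4 + (e ^ 2 - e ^ 11) * v 5,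
    (e ^ 5 - e ^ 8) * v 0 + (e ^ 2 - e ^ 11) * v 1 + (e ^ 6 - e ^ 7) * v 2 +
      (e - e ^ 12) * v 3 + (e ^ 3 - e ^ 10) * v 4 + (e ^ 9 - e ^ 4) * v 5,
    (e ^ 2 - e ^ 11) * v 0 + (e ^ 6 - e ^ 7) * v 1 + (e ^ 5 - e ^ 8) * v 2 +
      (e ^ 3 - e ^ 10) * v 3 + (e ^ 9 - e ^ 4) * v 4 + (e - e ^ 12) * v 5,
    (e ^ 6 - e ^ 7) * v 0 + (e ^ 5 - e ^ 8) * v 1 + (e ^ 2 - e ^ 11) * v 2 +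
      (e ^ 9 - e ^ 4) * v 3 + (e - e ^ 12) * v 4 + (e ^ 3 - e ^ 10) * v 5]

set_option maxHeartbeats 2000000 in
theorem D_zero_sineTransform {e : ℂ} (he : e ^ 13 = 1) (v : Fin 6 → ℂ) (a b : ℂ)
    (ha : a = e + e ^ 3 + e ^ 9 - e ^ 4 - e ^ 10 - e ^ 12)
    (hb : b = e ^ 2 + e ^ 5 + e ^ 6 - e ^ 7 - e ^ 8 - e ^ 11) :
    D 0 (sineTransform e v) = (2 * a - 3 * b) * D 0 v - (3 * a + 2 * b) * Dinf v
      + (a + b) * (D 1 v + D 3 v + D 9 v) + a * (D 2 v + D 5 v + D 6 v)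
      + (b - a) * (D 4 v + D 10 v + D 12 v) + b * (D 7 v + D 8 v + D 11 v) := by
  subst ha hb
  simp only [D, Dinf, sineTransform, Matrix.cons_val]
  linear_combination
    ((-e ^ 2 - e ^ 5 - e ^ 6 + e ^ 7 + e ^ 11 + e ^ 13 - e ^ 18) * (v 0 ^ 3) + (e - e ^ 2 + e ^ 3 -
      e ^ 4 - e ^ 6 + e ^ 7 + e ^ 8 + 2 * e ^ 9 - 2 * e ^ 10 + e ^ 11 - 2 * e ^ 12 - e ^ 14 - e ^ 16
      + e ^ 17 + e ^ 21) * (v 0 ^ 2 * v 1) + (2 * e + 2 * e ^ 2 + 2 * e ^ 3 - 2 * e ^ 4 + 2 * e ^ 5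
      + e ^ 6 - e ^ 7 - 2 * e ^ 8 + 2 * e ^ 9 - 2 * e ^ 10 - 2 * e ^ 12 + 2 * e ^ 15 + e ^ 19 - e ^
      20) * (v 0 ^ 2 * v 2) + (2 * e ^ 2 + 2 * e ^ 5 + 2 * e ^ 6 - e ^ 7 - 2 * e ^ 8 - e ^ 10 - e ^
      11 + e ^ 15 - e ^ 16 + e ^ 19) * (v 0 ^ 2 * v 3) + (e + e ^ 2 + e ^ 3 - e ^ 4 + e ^ 5 + e ^ 6
      - e ^ 7 - e ^ 8 + e ^ 9 - e ^ 10 - e ^ 12 + e ^ 15) * (v 0 ^ 2 * v 4) + (e + e ^ 3 - e ^ 4 - e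
      ^ 6 + e ^ 9 - e ^ 12 + e ^ 13 + e ^ 16 - e ^ 20) * (v 0 ^ 2 * v 5) + (2 * e + 2 * e ^ 2 + 2 *
      e ^ 3 - 2 * e ^ 4 + 2 * e ^ 5 + e ^ 6 - e ^ 7 - 2 * e ^ 8 + 2 * e ^ 9 - 2 * e ^ 10 - 2 * e ^
      12 + 2 * e ^ 15 + e ^ 19 - e ^ 20) * (v 0 * v 1 ^ 2) + (2 * e - 3 * e ^ 2 + 3 * e ^ 3 - 2 * e
      ^ 4 - 3 * e ^ 5 - 3 * e ^ 6 + 3 * e ^ 7 + 3 * e ^ 9 - 2 * e ^ 10 + 3 * e ^ 11 - 3 * e ^ 12 + 3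
      * e ^ 13 - e ^ 14 + e ^ 17 - 3 * e ^ 18 + e ^ 23) * (v 0 * v 1 * v 2) + (-e ^ 2 - e ^ 4 - e ^
      5 - e ^ 6 + e ^ 7 + e ^ 8 + 2 * e ^ 11 - e ^ 12 + e ^ 13 - e ^ 14 + e ^ 15 - e ^ 22) * (v 0 *
      v 1 * v 3) + (-3 * e ^ 2 - 3 * e ^ 5 - 4 * e ^ 6 + 3 * e ^ 7 + 2 * e ^ 8 + e ^ 9 + 2 * e ^ 11
      + e ^ 13 - e ^ 15 + e ^ 17 - e ^ 18 - e ^ 20) * (v 0 * v 1 * v 4) + (e - e ^ 2 + e ^ 3 - e ^ 4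
      - e ^ 5 - e ^ 6 + e ^ 7 + e ^ 9 - e ^ 10 + 2 * e ^ 11 - e ^ 12 + e ^ 15 - e ^ 18) * (v 0 * v 1
      * v 5) + (e - e ^ 2 + e ^ 3 - e ^ 4 - e ^ 6 + e ^ 7 + e ^ 8 + 2 * e ^ 9 - 2 * e ^ 10 + e ^ 11
      - 2 * e ^ 12 - e ^ 14 - e ^ 16 + e ^ 17 + e ^ 21) * (v 0 * v 2 ^ 2) + (-3 * e ^ 2 - 3 * e ^ 5
      - 4 * e ^ 6 + 3 * e ^ 7 + 2 * e ^ 8 + e ^ 9 + 2 * e ^ 11 + e ^ 13 - e ^ 15 + e ^ 17 - e ^ 18 -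
      e ^ 20) * (v 0 * v 2 * v 3) + (e - e ^ 2 + e ^ 3 - e ^ 4 - e ^ 5 - e ^ 6 + e ^ 7 + e ^ 9 - e ^
      10 + 2 * e ^ 11 - e ^ 12 + e ^ 15 - e ^ 18) * (v 0 * v 2 * v 4) + (-e ^ 2 - e ^ 4 - e ^ 5 - e
      ^ 6 + e ^ 7 + e ^ 8 + 2 * e ^ 11 - e ^ 12 + e ^ 13 - e ^ 14 + e ^ 15 - e ^ 22) * (v 0 * v 2 *
      v 5) + (-2 * e - 2 * e ^ 3 + 2 * e ^ 4 - e ^ 9 + e ^ 10 - e ^ 11 + 2 * e ^ 12 - e ^ 15 - e ^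
      16 + e ^ 17) * (v 0 * v 3 ^ 2) + (e + e ^ 3 - e ^ 4 + e ^ 9 - e ^ 10 - 2 * e ^ 12 + 3 * e ^ 13
      - e ^ 14) * (v 0 * v 3 * v 4) + (3 * e + 3 * e ^ 3 - 3 * e ^ 4 + e ^ 5 + 3 * e ^ 9 - 2 * e ^
      10 - 3 * e ^ 12 - e ^ 13 + e ^ 16 + e ^ 21) * (v 0 * v 3 * v 5) + (e ^ 2 + e ^ 5 + e ^ 6 - e ^
      7 - e ^ 8 + e ^ 10 - e ^ 11 - e ^ 13 + e ^ 16) * (v 0 * v 4 ^ 2) + (e + e ^ 2 + e ^ 3 - e ^ 4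
      + e ^ 5 + e ^ 6 - e ^ 8 + 2 * e ^ 9 - 2 * e ^ 10 - e ^ 11 - e ^ 12 - e ^ 16 + e ^ 17 + e ^ 19)
      * (v 0 * v 4 * v 5) + (-e + e ^ 2 - e ^ 3 + e ^ 4 + e ^ 5 + e ^ 6 - e ^ 7 - e ^ 9 + e ^ 10 - e
      ^ 11 - e ^ 14 + e ^ 18) * (v 0 * v 5 ^ 2) + (-e ^ 2 - e ^ 5 - e ^ 6 + e ^ 7 + e ^ 11 + e ^ 13
      - e ^ 18) * (v 1 ^ 3) + (e - e ^ 2 + e ^ 3 - e ^ 4 - e ^ 6 + e ^ 7 + e ^ 8 + 2 * e ^ 9 - 2 * e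
      ^ 10 + e ^ 11 - 2 * e ^ 12 - e ^ 14 - e ^ 16 + e ^ 17 + e ^ 21) * (v 1 ^ 2 * v 2) + (e + e ^ 3
      - e ^ 4 - e ^ 6 + e ^ 9 - e ^ 12 + e ^ 13 + e ^ 16 - e ^ 20) * (v 1 ^ 2 * v 3) + (2 * e ^ 2 +
      2 * e ^ 5 + 2 * e ^ 6 - e ^ 7 - 2 * e ^ 8 - e ^ 10 - e ^ 11 + e ^ 15 - e ^ 16 + e ^ 19) * (v 1
      ^ 2 * v 4) + (e + e ^ 2 + e ^ 3 - e ^ 4 + e ^ 5 + e ^ 6 - e ^ 7 - e ^ 8 + e ^ 9 - e ^ 10 - e ^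
      12 + e ^ 15) * (v 1 ^ 2 * v 5) + (2 * e + 2 * e ^ 2 + 2 * e ^ 3 - 2 * e ^ 4 + 2 * e ^ 5 + e ^
      6 - e ^ 7 - 2 * e ^ 8 + 2 * e ^ 9 - 2 * e ^ 10 - 2 * e ^ 12 + 2 * e ^ 15 + e ^ 19 - e ^ 20) *
      (v 1 * v 2 ^ 2) + (e - e ^ 2 + e ^ 3 - e ^ 4 - e ^ 5 - e ^ 6 + e ^ 7 + e ^ 9 - e ^ 10 + 2 * e
      ^ 11 - e ^ 12 + e ^ 15 - e ^ 18) * (v 1 * v 2 * v 3) + (-e ^ 2 - e ^ 4 - e ^ 5 - e ^ 6 + e ^ 7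
      + e ^ 8 + 2 * e ^ 11 - e ^ 12 + e ^ 13 - e ^ 14 + e ^ 15 - e ^ 22) * (v 1 * v 2 * v 4) + (-3 *
      e ^ 2 - 3 * e ^ 5 - 4 * e ^ 6 + 3 * e ^ 7 + 2 * e ^ 8 + e ^ 9 + 2 * e ^ 11 + e ^ 13 - e ^ 15 +
      e ^ 17 - e ^ 18 - e ^ 20) * (v 1 * v 2 * v 5) + (-e + e ^ 2 - e ^ 3 + e ^ 4 + e ^ 5 + e ^ 6 -
      e ^ 7 - e ^ 9 + e ^ 10 - e ^ 11 - e ^ 14 + e ^ 18) * (v 1 * v 3 ^ 2) + (3 * e + 3 * e ^ 3 - 3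
      * e ^ 4 + e ^ 5 + 3 * e ^ 9 - 2 * e ^ 10 - 3 * e ^ 12 - e ^ 13 + e ^ 16 + e ^ 21) * (v 1 * v 3
      * v 4) + (e + e ^ 2 + e ^ 3 - e ^ 4 + e ^ 5 + e ^ 6 - e ^ 8 + 2 * e ^ 9 - 2 * e ^ 10 - e ^ 11
      - e ^ 12 - e ^ 16 + e ^ 17 + e ^ 19) * (v 1 * v 3 * v 5) + (-2 * e - 2 * e ^ 3 + 2 * e ^ 4 - e
      ^ 9 + e ^ 10 - e ^ 11 + 2 * e ^ 12 - e ^ 15 - e ^ 16 + e ^ 17) * (v 1 * v 4 ^ 2) + (e + e ^ 3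
      - e ^ 4 + e ^ 9 - e ^ 10 - 2 * e ^ 12 + 3 * e ^ 13 - e ^ 14) * (v 1 * v 4 * v 5) + (e ^ 2 + e
      ^ 5 + e ^ 6 - e ^ 7 - e ^ 8 + e ^ 10 - e ^ 11 - e ^ 13 + e ^ 16) * (v 1 * v 5 ^ 2) + (-e ^ 2 -
      e ^ 5 - e ^ 6 + e ^ 7 + e ^ 11 + e ^ 13 - e ^ 18) * (v 2 ^ 3) + (e + e ^ 2 + e ^ 3 - e ^ 4 + e
      ^ 5 + e ^ 6 - e ^ 7 - e ^ 8 + e ^ 9 - e ^ 10 - e ^ 12 + e ^ 15) * (v 2 ^ 2 * v 3) + (e + e ^ 3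
      - e ^ 4 - e ^ 6 + e ^ 9 - e ^ 12 + e ^ 13 + e ^ 16 - e ^ 20) * (v 2 ^ 2 * v 4) + (2 * e ^ 2 +
      2 * e ^ 5 + 2 * e ^ 6 - e ^ 7 - 2 * e ^ 8 - e ^ 10 - e ^ 11 + e ^ 15 - e ^ 16 + e ^ 19) * (v 2
      ^ 2 * v 5) + (e ^ 2 + e ^ 5 + e ^ 6 - e ^ 7 - e ^ 8 + e ^ 10 - e ^ 11 - e ^ 13 + e ^ 16) * (v
      2 * v 3 ^ 2) + (e + e ^ 2 + e ^ 3 - e ^ 4 + e ^ 5 + e ^ 6 - e ^ 8 + 2 * e ^ 9 - 2 * e ^ 10 - e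
      ^ 11 - e ^ 12 - e ^ 16 + e ^ 17 + e ^ 19) * (v 2 * v 3 * v 4) + (e + e ^ 3 - e ^ 4 + e ^ 9 - e
      ^ 10 - 2 * e ^ 12 + 3 * e ^ 13 - e ^ 14) * (v 2 * v 3 * v 5) + (-e + e ^ 2 - e ^ 3 + e ^ 4 + e
      ^ 5 + e ^ 6 - e ^ 7 - e ^ 9 + e ^ 10 - e ^ 11 - e ^ 14 + e ^ 18) * (v 2 * v 4 ^ 2) + (3 * e +
      3 * e ^ 3 - 3 * e ^ 4 + e ^ 5 + 3 * e ^ 9 - 2 * e ^ 10 - 3 * e ^ 12 - e ^ 13 + e ^ 16 + e ^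
      21) * (v 2 * v 4 * v 5) + (-2 * e - 2 * e ^ 3 + 2 * e ^ 4 - e ^ 9 + e ^ 10 - e ^ 11 + 2 * e ^
      12 - e ^ 15 - e ^ 16 + e ^ 17) * (v 2 * v 5 ^ 2) + (-e - e ^ 3 + e ^ 4 - e ^ 9 + e ^ 10 + e ^
      12 - e ^ 13) * (v 3 ^ 3) + (-e - e ^ 2 - e ^ 3 + e ^ 4 - e ^ 5 - e ^ 6 + e ^ 7 + e ^ 8 - e ^ 9
      + 2 * e ^ 11 - e ^ 14 + e ^ 15 - e ^ 16) * (v 3 ^ 2 * v 4) + (2 * e - 2 * e ^ 2 + 2 * e ^ 3 -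
      2 * e ^ 4 - 2 * e ^ 5 - 2 * e ^ 6 + 2 * e ^ 7 + 2 * e ^ 8 + e ^ 9 - 2 * e ^ 10 + 2 * e ^ 11 -
      e ^ 12 + e ^ 14 - e ^ 17) * (v 3 ^ 2 * v 5) + (2 * e - 2 * e ^ 2 + 2 * e ^ 3 - 2 * e ^ 4 - 2 *
      e ^ 5 - 2 * e ^ 6 + 2 * e ^ 7 + 2 * e ^ 8 + e ^ 9 - 2 * e ^ 10 + 2 * e ^ 11 - e ^ 12 + e ^ 14
      - e ^ 17) * (v 3 * v 4 ^ 2) + (-3 * e - 2 * e ^ 2 - 3 * e ^ 3 + 3 * e ^ 4 - 2 * e ^ 5 - 3 * e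
      ^ 6 + 2 * e ^ 7 + 2 * e ^ 8 - 3 * e ^ 9 + 3 * e ^ 10 + 2 * e ^ 11 + 3 * e ^ 12 - 3 * e ^ 13 -
      e ^ 20) * (v 3 * v 4 * v 5) + (-e - e ^ 2 - e ^ 3 + e ^ 4 - e ^ 5 - e ^ 6 + e ^ 7 + e ^ 8 - e
      ^ 9 + 2 * e ^ 11 - e ^ 14 + e ^ 15 - e ^ 16) * (v 3 * v 5 ^ 2) + (-e - e ^ 3 + e ^ 4 - e ^ 9 +
      e ^ 10 + e ^ 12 - e ^ 13) * (v 4 ^ 3) + (-e - e ^ 2 - e ^ 3 + e ^ 4 - e ^ 5 - e ^ 6 + e ^ 7 +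
      e ^ 8 - e ^ 9 + 2 * e ^ 11 - e ^ 14 + e ^ 15 - e ^ 16) * (v 4 ^ 2 * v 5) + (2 * e - 2 * e ^ 2
      + 2 * e ^ 3 - 2 * e ^ 4 - 2 * e ^ 5 - 2 * e ^ 6 + 2 * e ^ 7 + 2 * e ^ 8 + e ^ 9 - 2 * e ^ 10 +
      2 * e ^ 11 - e ^ 12 + e ^ 14 - e ^ 17) * (v 4 * v 5 ^ 2) + (-e - e ^ 3 + e ^ 4 - e ^ 9 + e ^
      10 + e ^ 12 - e ^ 13) * (v 5 ^ 3)) * he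

theorem sum_Icc_one_twelve (f : ℕ → ℂ) : ∑ j ∈ Finset.Icc 1 12, f j =
    f 1 + f 2 + f 3 + f 4 + f 5 + f 6 + f 7 + f 8 + f 9 + f 10 + f 11 + f 12 := by
  simp [Finset.sum_Icc_succ_top]

theorem Dinf_sineTransform {e : ℂ} (he : e ^ 13 = 1) (v : Fin 6 → ℂ) (a b : ℂ)
    (ha : a = e + e ^ 3 + e ^ 9 - e ^ 4 - e ^ 10 - e ^ 12)
    (hb : b = e ^ 2 + e ^ 5 + e ^ 6 - e ^ 7 - e ^ 8 - e ^ 11) :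
    Dinf (sineTransform e v) = -(3 * a + 2 * b) * D 0 v + (3 * b - 2 * a) * Dinf v
      + (a - b) * (D 1 v + D 3 v + D 9 v) - b * (D 2 v + D 5 v + D 6 v)
      + (a + b) * (D 4 v + D 10 v + D 12 v) + a * (D 7 v + D 8 v + D 11 v) := by
  have h : Dinf (sineTransform e v) =
      D 0 (sineTransform e ![-v 3, -v 4, -v 5, v 0, v 1, v 2]) := by
    simp only [D, Dinf, sineTransform, Matrix.cons_val]
    ring
  rw [h, D_zero_sineTransform he _ a b ha hb]
  simp only [D, Dinf, Matrix.cons_val]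
  ring

theorem Gs_zero_sineTransform {e : ℂ} (he : e ^ 13 = 1) (he1 : e ≠ 1) (v : Fin 6 → ℂ) :
    Gs 0 (sineTransform e v) = 13 * (-13 * Gs 0 v + ∑ j ∈ Finset.Icc 1 12, Gs j v) := by
  obtain ⟨a, ha⟩ : ∃ a, a = e + e ^ 3 + e ^ 9 - e ^ 4 - e ^ 10 - e ^ 12 := ⟨_, rfl⟩
  obtain ⟨b, hb⟩ : ∃ b, b = e ^ 2 + e ^ 5 + e ^ 6 - e ^ 7 - e ^ 8 - e ^ 11 := ⟨_, rfl⟩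
  have hsum : 1 + e + e ^ 2 + e ^ 3 + e ^ 4 + e ^ 5 + e ^ 6 + e ^ 7 + e ^ 8 + e ^ 9 + e ^ 10
      + e ^ 11 + e ^ 12 = 0 := by
    refine mul_left_cancel₀ (sub_ne_zero.2 he1) ?_
    linear_combination he
  have hab : a ^ 2 + b ^ 2 = -13 := by
    rw [ha, hb]
    linear_combination (-12 + e + e ^ 3 - 2 * e ^ 4 + 3 * e ^ 5 + e ^ 7 - 2 * e ^ 8 + 3 * e ^ 9
      + e ^ 11) * he + hsum
  simp only [sum_Icc_one_twelve, Gs, D_zero_sineTransform he v a b ha hb,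
    Dinf_sineTransform he v a b ha hb]
  linear_combination ((2 * D 0 v - 3 * Dinf v + (D 1 v + D 3 v + D 9 v) + (D 2 v + D 5 v + D 6 v)
    - (D 4 v + D 10 v + D 12 v)) ^ 2 + (-3 * D 0 v - 2 * Dinf v + (D 1 v + D 3 v + D 9 v)
    + (D 4 v + D 10 v + D 12 v) + (D 7 v + D 8 v + D 11 v)) ^ 2) * hab

/-- The diagonal action of `T` with `ζ` replaced by an arbitrary `13`-th root of unity. -/
def chirpVec (e : ℂ) (v : Fin 6 → ℂ) : Fin 6 → ℂ :=
  ![e ^ 7 * v 0, e ^ 11 * v 1, e ^ 8 * v 2, e ^ 6 * v 3, e ^ 2 * v 4, e ^ 5 * v 5]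

theorem Dinf_chirpVec {e : ℂ} (he : e ^ 13 = 1) (v : Fin 6 → ℂ) :
    Dinf (chirpVec e v) = Dinf v := by
  simp only [Dinf, chirpVec, Matrix.cons_val]
  linear_combination (v 3 * v 4 * v 5) * he

theorem D_chirpVec {e : ℂ} (he : e ^ 13 = 1) (v : Fin 6 → ℂ) {j : ℕ} (hj : j ≤ 12) :
    D j (chirpVec e v) = e ^ j * D j v := by
  interval_cases j <;> simp only [D, chirpVec, Matrix.cons_val]
  · linear_combination ((e ^ 13 + 1) * v 0 * v 1 * v 2) * he
  · linear_combination (2 * (e ^ 13 + 1) * e * v 1 * v 2 ^ 2 + (e ^ 13 + 1) * e * v 1 ^ 2 *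
      v 5 - e * v 3 ^ 2 * v 4 + e * v 0 * v 4 * v 5) * he
  · linear_combination (-e ^ 2 * v 5 ^ 3 + (e ^ 13 + 1) * e ^ 2 * v 1 ^ 2 * v 3 - 2 * e ^ 2
      * v 1 * v 4 ^ 2 + e ^ 2 * v 0 * v 3 * v 4 + 3 * e ^ 2 * v 2 * v 4 * v 5) * he
  · linear_combination (2 * (e ^ 13 + 1) * e ^ 3 * v 0 * v 1 ^ 2 + e ^ 3 * v 0 ^ 2 * v 4 -
      e ^ 3 * v 3 * v 5 ^ 2 + e ^ 3 * v 2 * v 3 * v 4) * he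
  · linear_combination (-(e ^ 13 + 1) * e ^ 4 * v 1 ^ 2 * v 2 + e ^ 4 * v 0 * v 5 ^ 2 - 2 *
      e ^ 4 * v 3 ^ 2 * v 5 - e ^ 4 * v 0 * v 2 * v 4) * he
  · linear_combination (-e ^ 5 * v 3 ^ 3 + e ^ 5 * v 2 ^ 2 * v 4 - 2 * e ^ 5 * v 2 * v 5 ^ 2
      + e ^ 5 * v 1 * v 4 * v 5 + 3 * e ^ 5 * v 0 * v 3 * v 5) * he
  · linear_combination (e ^ 6 * v 0 ^ 2 * v 5 - 2 * e ^ 6 * v 0 * v 3 ^ 2 + e ^ 6 * v 2 *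
      v 3 * v 5 + 3 * e ^ 6 * v 1 * v 3 * v 4) * he
  · linear_combination (-(e ^ 13 + 1) * e ^ 7 * v 1 ^ 3 + e ^ 7 * v 2 * v 3 ^ 2 - e ^ 7 *
      v 0 * v 2 * v 5 - 3 * e ^ 7 * v 0 * v 1 * v 4 + 2 * e ^ 7 * v 0 ^ 2 * v 3) * he
  · linear_combination (-e ^ 8 * v 0 ^ 3 + e ^ 8 * v 1 * v 5 ^ 2 - e ^ 8 * v 1 * v 2 * v 4 -
      3 * e ^ 8 * v 0 * v 2 * v 3 + 2 * e ^ 8 * v 2 ^ 2 * v 5) * he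
  · linear_combination (2 * e ^ 9 * v 0 ^ 2 * v 2 + e ^ 9 * v 2 ^ 2 * v 3 + e ^ 9 * v 1 *
      v 3 * v 5) * he
  · linear_combination (-e ^ 10 * v 0 * v 2 ^ 2 + e ^ 10 * v 1 * v 3 ^ 2 - e ^ 10 * v 0 *
      v 1 * v 5) * he
  · linear_combination (-e ^ 11 * v 2 ^ 3 - e ^ 11 * v 0 * v 1 * v 3 - 3 * e ^ 11 * v 1 *
      v 2 * v 5 + 2 * e ^ 11 * v 1 ^ 2 * v 4) * he
  · linear_combination (-e ^ 12 * v 0 ^ 2 * v 1 - e ^ 12 * v 1 * v 2 * v 3) * he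

theorem Gs_chirpVec {e : ℂ} (he : e ^ 13 = 1) (v : Fin 6 → ℂ) {j : ℕ} (hj : j ≤ 12) :
    Gs j (chirpVec e v) = e ^ j * Gs j v := by
  have hD {i : ℕ} (hi : i ≤ 12) := D_chirpVec he v hi
  interval_cases j <;> simp only [Gs, hD, Dinf_chirpVec he, Nat.reduceLeDiff]
  · ring
  · linear_combination (-e * D 7 v ^ 2 + e * 2 * D 2 v * D 12 v - e * 2 * D 3 v * D 11 v - e
      * 4 * D 4 v * D 10 v - e * 2 * D 9 v * D 5 v) * he
  · linear_combination (-e ^ 2 * 2 * D 4 v * D 11 v + e ^ 2 * 2 * D 5 v * D 10 v - e ^ 2 * 2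
      * D 6 v * D 9 v - e ^ 2 * 2 * D 7 v * D 8 v) * he
  · linear_combination (-e ^ 3 * D 8 v ^ 2 + e ^ 3 * 2 * D 6 v * D 10 v - e ^ 3 * 2 * D 9 v
      * D 7 v - e ^ 3 * 4 * D 12 v * D 4 v) * he
  · linear_combination (e ^ 4 * 2 * D 5 v * D 12 v - e ^ 4 * 2 * D 9 v * D 8 v - e ^ 4 * 2 *
      D 10 v * D 7 v) * he
  · linear_combination (-e ^ 5 * 2 * D 9 v ^ 2 - e ^ 5 * 2 * D 10 v * D 8 v + e ^ 5 * 2 *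
      D 6 v * D 12 v - e ^ 5 * 2 * D 11 v * D 7 v) * he
  · linear_combination (-e ^ 6 * 2 * D 12 v * D 7 v - e ^ 6 * 2 * D 8 v * D 11 v) * he
  · linear_combination (-e ^ 7 * 2 * D 10 v ^ 2 - e ^ 7 * 2 * D 8 v * D 12 v - e ^ 7 * 2 *
      D 9 v * D 11 v) * he
  · linear_combination (-e ^ 8 * 2 * D 11 v * D 10 v) * he
  · linear_combination (-e ^ 9 * D 11 v ^ 2 - e ^ 9 * 4 * D 10 v * D 12 v) * he
  · linear_combination (-e ^ 10 * 2 * D 12 v * D 11 v) * he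
  · linear_combination (-e ^ 11 * 2 * D 12 v ^ 2) * he
  · ring

instance fact_prime_thirteen : Fact (Nat.Prime 13) := ⟨by norm_num⟩

/-- The coordinates of an odd function on `ZMod 13`, at the representatives `1, 3, 9, 8, 11, 7`
of the nonzero residues up to sign. -/
def oddVec (u : ZMod 13 → ℂ) : Fin 6 → ℂ := ![u 1, u 3, u 9, u 8, u 11, u 7]

/-- The unnormalised Fourier transform on `ZMod 13`. -/
def fourier13 (u : ZMod 13 → ℂ) (x : ZMod 13) : ℂ := ∑ y, ZMod.stdAddChar (-(x * y)) * u y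

/-- Multiplication by the quadratic character `x ↦ ψ (ν x² / 2)`. -/
def chirp (ν : ZMod 13) (u : ZMod 13 → ℂ) (x : ZMod 13) : ℂ :=
  ZMod.stdAddChar (7 * ν * x ^ 2) * u x

theorem stdAddChar_natCast (n : ℕ) : ZMod.stdAddChar (n : ZMod 13) = zeta13 ^ n := by
  have h := ZMod.stdAddChar_coe (N := 13) n
  rw [Int.cast_natCast] at h
  rw [h, zeta13, ← Complex.exp_nat_mul]
  congr 1
  push_cast
  ring

theorem zeta13_pow : zeta13 ^ 13 = 1 := by
  rw [← stdAddChar_natCast, show ((13 : ℕ) : ZMod 13) = 0 from rfl, AddChar.map_zero_eq_one]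

theorem zeta13_ne_one : zeta13 ≠ 1 := by
  have h := stdAddChar_natCast 1
  rw [pow_one] at h
  rw [← h, ← AddChar.map_zero_eq_one (ZMod.stdAddChar (N := 13))]
  exact fun h' => absurd (ZMod.injective_stdAddChar h') (by decide)

theorem oddVec_fourier13 {u : ZMod 13 → ℂ} (hu : ∀ x, u (-x) = -u x) :
    oddVec (fourier13 u) = sineTransform zeta13 (oddVec u) := by
  have h0 : u 0 = 0 := by
    have := hu 0
    rw [neg_zero] at this
    linear_combination this / 2
  have h (n : ℕ) (x : ZMod 13) (hx : x = n) : ZMod.stdAddChar x = zeta13 ^ n :=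
    hx ▸ stdAddChar_natCast n
  have hsum (f : Fin 13 → ℂ) : ∑ y, f y = f 0 + f 1 + f 2 + f 3 + f 4 + f 5 + f 6 + f 7 + f 8
      + f 9 + f 10 + f 11 + f 12 := by
    rw [Fin.sum_univ_castSucc, Fin.sum_univ_castSucc, Fin.sum_univ_castSucc,
      Fin.sum_univ_castSucc, Fin.sum_univ_castSucc, Fin.sum_univ_eight]
    rfl
  have key (x : ZMod 13) : fourier13 u x = ∑ y ∈ ({1, 3, 9, 8, 11, 7} : Finset (ZMod 13)),
      (ZMod.stdAddChar (-(x * y)) - ZMod.stdAddChar (x * y)) * u y := by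
    refine (hsum _).trans ?_
    rw [Finset.sum_insert (by decide), Finset.sum_insert (by decide), Finset.sum_insert (by decide),
      Finset.sum_insert (by decide), Finset.sum_insert (by decide), Finset.sum_singleton]
    have hn (a b : ZMod 13) (hab : a = -b) :
        ZMod.stdAddChar (-(x * a)) * u a = -(ZMod.stdAddChar (x * b) * u b) := by
      rw [hab, hu, mul_neg, mul_neg, neg_neg]
    linear_combination hn 2 11 (by decide) + hn 4 9 (by decide) + hn 5 8 (by decide)
      + hn 6 7 (by decide) + hn 10 3 (by decide) + hn 12 1 (by decide)
      + ZMod.stdAddChar (-(x * 0)) * h0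
  have hz (x y : ZMod 13) : ZMod.stdAddChar (-(x * y)) - ZMod.stdAddChar (x * y) =
      zeta13 ^ (-(x * y)).val - zeta13 ^ (x * y).val := by
    rw [h _ _ (ZMod.natCast_zmod_val _).symm, h _ _ (ZMod.natCast_zmod_val _).symm]
  have key' (x : ZMod 13) : fourier13 u x = (zeta13 ^ (-(x * 1)).val - zeta13 ^ (x * 1).val) * u 1
      + (zeta13 ^ (-(x * 3)).val - zeta13 ^ (x * 3).val) * u 3
      + (zeta13 ^ (-(x * 9)).val - zeta13 ^ (x * 9).val) * u 9
      + (zeta13 ^ (-(x * 8)).val - zeta13 ^ (x * 8).val) * u 8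
      + (zeta13 ^ (-(x * 11)).val - zeta13 ^ (x * 11).val) * u 11
      + (zeta13 ^ (-(x * 7)).val - zeta13 ^ (x * 7).val) * u 7 := by
    rw [key, Finset.sum_insert (by decide), Finset.sum_insert (by decide),
      Finset.sum_insert (by decide), Finset.sum_insert (by decide), Finset.sum_insert (by decide),
      Finset.sum_singleton]
    simp only [hz]
    ring
  ext i
  fin_cases i
  · refine (key' 1).trans ?_
    change (zeta13 ^ 12 - zeta13 ^ 1) * u 1 + (zeta13 ^ 10 - zeta13 ^ 3) * u 3
      + (zeta13 ^ 4 - zeta13 ^ 9) * u 9 + (zeta13 ^ 5 - zeta13 ^ 8) * u 8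
      + (zeta13 ^ 2 - zeta13 ^ 11) * u 11 + (zeta13 ^ 6 - zeta13 ^ 7) * u 7 = _
    rw [pow_one]
    rfl
  · refine (key' 3).trans ?_
    change (zeta13 ^ 10 - zeta13 ^ 3) * u 1 + (zeta13 ^ 4 - zeta13 ^ 9) * u 3
      + (zeta13 ^ 12 - zeta13 ^ 1) * u 9 + (zeta13 ^ 2 - zeta13 ^ 11) * u 8
      + (zeta13 ^ 6 - zeta13 ^ 7) * u 11 + (zeta13 ^ 5 - zeta13 ^ 8) * u 7 = _
    rw [pow_one]
    rfl
  · refine (key' 9).trans ?_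
    change (zeta13 ^ 4 - zeta13 ^ 9) * u 1 + (zeta13 ^ 12 - zeta13 ^ 1) * u 3
      + (zeta13 ^ 10 - zeta13 ^ 3) * u 9 + (zeta13 ^ 6 - zeta13 ^ 7) * u 8
      + (zeta13 ^ 5 - zeta13 ^ 8) * u 11 + (zeta13 ^ 2 - zeta13 ^ 11) * u 7 = _
    rw [pow_one]
    rfl
  · refine (key' 8).trans ?_
    change (zeta13 ^ 5 - zeta13 ^ 8) * u 1 + (zeta13 ^ 2 - zeta13 ^ 11) * u 3
      + (zeta13 ^ 6 - zeta13 ^ 7) * u 9 + (zeta13 ^ 1 - zeta13 ^ 12) * u 8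
      + (zeta13 ^ 3 - zeta13 ^ 10) * u 11 + (zeta13 ^ 9 - zeta13 ^ 4) * u 7 = _
    rw [pow_one]
    rfl
  · refine (key' 11).trans ?_
    change (zeta13 ^ 2 - zeta13 ^ 11) * u 1 + (zeta13 ^ 6 - zeta13 ^ 7) * u 3
      + (zeta13 ^ 5 - zeta13 ^ 8) * u 9 + (zeta13 ^ 3 - zeta13 ^ 10) * u 8
      + (zeta13 ^ 9 - zeta13 ^ 4) * u 11 + (zeta13 ^ 1 - zeta13 ^ 12) * u 7 = _
    rw [pow_one]
    rfl
  · refine (key' 7).trans ?_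
    change (zeta13 ^ 6 - zeta13 ^ 7) * u 1 + (zeta13 ^ 5 - zeta13 ^ 8) * u 3
      + (zeta13 ^ 2 - zeta13 ^ 11) * u 9 + (zeta13 ^ 9 - zeta13 ^ 4) * u 8
      + (zeta13 ^ 1 - zeta13 ^ 12) * u 11 + (zeta13 ^ 3 - zeta13 ^ 10) * u 7 = _
    rw [pow_one]
    rfl

theorem oddVec_chirp (ν : ZMod 13) (u : ZMod 13 → ℂ) :
    oddVec (chirp ν u) = chirpVec (ZMod.stdAddChar ν) (oddVec u) := by
  have h (n : ℕ) (x : ZMod 13) (hx : 7 * x ^ 2 = n) :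
      chirp ν u x = ZMod.stdAddChar ν ^ n * u x := by
    rw [chirp, ← AddChar.map_nsmul_eq_pow, nsmul_eq_mul, ← hx]
    ring_nf
  simp only [oddVec, chirpVec, Matrix.cons_val]
  rw [h 7 1 (by decide), h 11 3 (by decide), h 8 9 (by decide), h 6 8 (by decide),
    h 2 11 (by decide), h 5 7 (by decide)]

theorem fourier13_neg {u : ZMod 13 → ℂ} (hu : ∀ x, u (-x) = -u x) (x : ZMod 13) :
    fourier13 u (-x) = -fourier13 u x := by
  rw [fourier13, fourier13, ← Finset.sum_neg_distrib, ← Equiv.sum_comp (Equiv.neg (ZMod 13))]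
  simp [hu]

theorem chirp_neg (ν : ZMod 13) {u : ZMod 13 → ℂ} (hu : ∀ x, u (-x) = -u x) (x : ZMod 13) :
    chirp ν u (-x) = -chirp ν u x := by
  simp [chirp, hu]

theorem chirp_chirp (μ ν : ZMod 13) (u : ZMod 13 → ℂ) :
    chirp μ (chirp ν u) = chirp (μ + ν) u := by
  ext x
  rw [chirp, chirp, chirp, ← mul_assoc, ← AddChar.map_add_eq_mul]
  ring_nf

theorem chirp_zero (u : ZMod 13 → ℂ) : chirp 0 u = u := by
  ext x
  simp [chirp]

/-- The quadratic Gauss sum. -/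
def gaussSum13 (ν : ZMod 13) : ℂ := ∑ y : ZMod 13, ZMod.stdAddChar (7 * ν * y ^ 2)

theorem sum_stdAddChar_mul (x : ZMod 13) :
    ∑ y : ZMod 13, ZMod.stdAddChar (x * y) = if x = 0 then (13 : ℂ) else 0 := by
  simpa [mul_comm] using AddChar.sum_mulShift x (ZMod.isPrimitive_stdAddChar 13)

theorem gaussSum13_sq {ν : ZMod 13} (hν : ν ≠ 0) : gaussSum13 ν ^ 2 = 13 := by
  have h13 : (13 : ZMod 13) = 0 := rfl
  have h (w : ZMod 13) : gaussSum13 ν * ZMod.stdAddChar (7 * ν * w ^ 2) =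
      ∑ y : ZMod 13, ZMod.stdAddChar (7 * ν * y ^ 2) * ZMod.stdAddChar (5 * ν * y * w) := by
    rw [gaussSum13, ← Equiv.sum_comp (Equiv.addRight (5 * w)), Finset.sum_mul]
    refine Finset.sum_congr rfl fun y _ => ?_
    rw [← AddChar.map_add_eq_mul, ← AddChar.map_add_eq_mul]
    congr 1
    simp only [Equiv.coe_addRight]
    linear_combination (5 * ν * y * w + 14 * ν * w ^ 2) * h13
  rw [sq]
  nth_rw 2 [gaussSum13]
  rw [Finset.mul_sum]
  simp_rw [h]
  rw [Finset.sum_comm]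
  simp_rw [← Finset.mul_sum, sum_stdAddChar_mul]
  rw [Finset.sum_eq_single 0]
  · simp
  · intro y _ hy
    have h5 : (5 : ZMod 13) ≠ 0 := by decide
    simp [hy, hν, h5]
  · simp

theorem fourier13_chirp_fourier13 {ν : ZMod 13} (hν : ν ≠ 0) (u : ZMod 13 → ℂ) :
    fourier13 (chirp ν (fourier13 u)) =
      gaussSum13 ν • chirp (-ν⁻¹) (fun x => fourier13 (chirp (-ν⁻¹) u) (ν⁻¹ * x)) := by
  have h13 : (13 : ZMod 13) = 0 := rfl
  have hc : ν * ν⁻¹ = 1 := mul_inv_cancel₀ hν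
  ext x
  simp only [fourier13, chirp, Pi.smul_apply, smul_eq_mul, Finset.mul_sum]
  rw [Finset.sum_comm]
  refine Finset.sum_congr rfl fun w _ => ?_
  rw [gaussSum13, Finset.sum_mul, ← Equiv.sum_comp (Equiv.addRight (ν⁻¹ * (x + w)))]
  refine Finset.sum_congr rfl fun y _ => ?_
  simp only [← mul_assoc, ← AddChar.map_add_eq_mul]
  congr 2
  simp only [Equiv.coe_addRight]
  linear_combination (14 * y * (x + w) + 7 * ν⁻¹ * (x + w) ^ 2) * hc
    + ((x + w) * y + ν⁻¹ * (x ^ 2 + x * w + w ^ 2)) * h13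

theorem fourier13_fourier13 (u : ZMod 13 → ℂ) (x : ZMod 13) :
    fourier13 (fourier13 u) x = 13 * u (-x) := by
  simp only [fourier13, Finset.mul_sum]
  rw [Finset.sum_comm]
  simp only [← mul_assoc, ← AddChar.map_add_eq_mul, ← Finset.sum_mul]
  have hs (y : ZMod 13) : ∑ w, ZMod.stdAddChar (-(x * w) + -(w * y)) =
      if -(x + y) = 0 then (13 : ℂ) else 0 := by
    rw [← sum_stdAddChar_mul]
    refine Finset.sum_congr rfl fun w _ => ?_
    ring_nf
  simp only [hs]
  rw [Finset.sum_eq_single (-x)]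
  · simp
  · intro y _ hy
    rw [if_neg fun h => hy ?_, zero_mul]
    rw [neg_eq_zero] at h
    exact eq_neg_of_add_eq_zero_right h
  · simp

theorem Gs_zero_smul (c : ℂ) (v : Fin 6 → ℂ) : Gs 0 (c • v) = c ^ 6 * Gs 0 v := by
  simp only [Gs, D, Dinf, Pi.smul_apply, smul_eq_mul]
  ring

theorem oddVec_smul (c : ℂ) (u : ZMod 13 → ℂ) : oddVec (c • u) = c • oddVec u := by
  ext i
  fin_cases i <;> rfl

theorem Gs_zero_oddVec_chirp (ν : ZMod 13) (u : ZMod 13 → ℂ) :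
    Gs 0 (oddVec (chirp ν u)) = Gs 0 (oddVec u) := by
  rw [oddVec_chirp, Gs_chirpVec _ _ (by norm_num), pow_zero, one_mul]
  rw [← AddChar.map_nsmul_eq_pow, nsmul_eq_mul, show ((13 : ℕ) : ZMod 13) = 0 from rfl, zero_mul,
    AddChar.map_zero_eq_one]

theorem Gs_zero_oddVec_two_mul {u : ZMod 13 → ℂ} (hu : ∀ x, u (-x) = -u x) :
    Gs 0 (oddVec fun x => u (2 * x)) = Gs 0 (oddVec u) := by
  have e2 : u 2 = -u 11 := hu 11
  have e5 : u 5 = -u 8 := hu 8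
  have e6 : u 6 = -u 7 := hu 7
  simp only [oddVec, Gs, D, Dinf, Matrix.cons_val]
  rw [show (2 * 1 : ZMod 13) = 2 by decide, show (2 * 3 : ZMod 13) = 6 by decide,
    show (2 * 9 : ZMod 13) = 5 by decide, show (2 * 8 : ZMod 13) = 3 by decide,
    show (2 * 11 : ZMod 13) = 9 by decide, show (2 * 7 : ZMod 13) = 1 by decide, e2, e5, e6]
  ring

theorem Gs_zero_oddVec_mul {u : ZMod 13 → ℂ} (hu : ∀ x, u (-x) = -u x) {c : ZMod 13}
    (hc : c ≠ 0) : Gs 0 (oddVec fun x => u (c * x)) = Gs 0 (oddVec u) := by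
  obtain ⟨n, rfl⟩ : ∃ n : ℕ, c = 2 ^ n := by
    have : ∀ c : ZMod 13, c ≠ 0 → ∃ n ∈ Finset.range 12, c = 2 ^ n := by decide
    obtain ⟨n, -, h⟩ := this c hc
    exact ⟨n, h⟩
  clear hc
  induction n with
  | zero => simp
  | succ n ih =>
    rw [← ih, ← Gs_zero_oddVec_two_mul (u := fun x => u (2 ^ n * x))]
    · simp only [pow_succ, mul_assoc]
    · intro x
      rw [mul_neg, hu]

/-- The form `13 δ_ν` on odd functions. -/
def deltaOdd (ν : ZMod 13) (u : ZMod 13 → ℂ) : ℂ := Gs 0 (oddVec (fourier13 (chirp ν u)))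

theorem deltaOdd_natCast (n : ℕ) {u : ZMod 13 → ℂ} (hu : ∀ x, u (-x) = -u x) :
    deltaOdd n u = 13 * deltaF n (oddVec u) := by
  have he : (zeta13 ^ n) ^ 13 = 1 := by rw [← pow_mul, mul_comm, pow_mul, zeta13_pow, one_pow]
  rw [deltaOdd, oddVec_fourier13 (chirp_neg _ hu),
    Gs_zero_sineTransform zeta13_pow zeta13_ne_one, oddVec_chirp, stdAddChar_natCast,
    Gs_chirpVec he _ (by norm_num), deltaF, pow_zero, one_mul]
  congr 2
  refine Finset.sum_congr rfl fun j hj => ?_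
  rw [Gs_chirpVec he _ (Finset.mem_Icc.1 hj).2, ← pow_mul, mul_comm n]

theorem Phi12_oddVec {u : ZMod 13 → ℂ} (hu : ∀ x, u (-x) = -u x) :
    Phi12 (oddVec u) = -(1 / 676) * ((1 / 169) * ∑ ν, deltaOdd ν u ^ 2
      + (169 * Gs 0 (oddVec u)) ^ 2) := by
  have h : ∑ ν, deltaOdd ν u ^ 2 = 169 * ∑ n ∈ Finset.range 13, deltaF n (oddVec u) ^ 2 := by
    rw [Finset.mul_sum, Finset.sum_range]
    change ∑ ν : Fin 13, _ = _
    refine Finset.sum_congr rfl fun i _ => ?_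
    have := deltaOdd_natCast i hu
    rw [show ((i : ℕ) : ZMod 13) = i from ZMod.natCast_zmod_val (n := 13) i] at this
    rw [this]
    ring
  rw [Phi12, h, deltaInf]
  ring

theorem deltaOdd_fourier13 {ν : ZMod 13} (hν : ν ≠ 0) {u : ZMod 13 → ℂ}
    (hu : ∀ x, u (-x) = -u x) : deltaOdd ν (fourier13 u) = 13 ^ 3 * deltaOdd (-ν⁻¹) u := by
  rw [deltaOdd, fourier13_chirp_fourier13 hν, oddVec_smul, Gs_zero_smul, Gs_zero_oddVec_chirp,
    Gs_zero_oddVec_mul (fourier13_neg (chirp_neg _ hu)) (inv_ne_zero hν), ← gaussSum13_sq hν,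
    deltaOdd]
  ring

theorem deltaOdd_zero_fourier13 {u : ZMod 13 → ℂ} (hu : ∀ x, u (-x) = -u x) :
    deltaOdd 0 (fourier13 u) = 13 ^ 6 * Gs 0 (oddVec u) := by
  have : fourier13 (fourier13 u) = (-13 : ℂ) • u := by
    ext x
    rw [fourier13_fourier13, hu, Pi.smul_apply, smul_eq_mul]
    ring
  rw [deltaOdd, chirp_zero, this, oddVec_smul, Gs_zero_smul]
  norm_num

theorem Phi12_oddVec_fourier13 {u : ZMod 13 → ℂ} (hu : ∀ x, u (-x) = -u x) :
    Phi12 (oddVec (fourier13 u)) = 13 ^ 6 * Phi12 (oddVec u) := by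
  have hinv : ∑ ν : ZMod 13, deltaOdd (-ν⁻¹) u ^ 2 = ∑ ν, deltaOdd ν u ^ 2 :=
    Equiv.sum_comp (Function.Involutive.toPerm (fun ν : ZMod 13 => -ν⁻¹)
      fun ν => by simp only [inv_neg, neg_neg, inv_inv]) fun ν => deltaOdd ν u ^ 2
  have hG : Gs 0 (oddVec (fourier13 u)) = deltaOdd 0 u := by rw [deltaOdd, chirp_zero]
  have hsum : ∑ ν, deltaOdd ν (fourier13 u) ^ 2 = 13 ^ 6 * ∑ ν, deltaOdd ν u ^ 2
      + 13 ^ 12 * Gs 0 (oddVec u) ^ 2 - 13 ^ 6 * deltaOdd 0 u ^ 2 := by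
    rw [← hinv, ← Finset.add_sum_erase _ _ (Finset.mem_univ 0),
      ← Finset.add_sum_erase (f := fun ν => deltaOdd (-ν⁻¹) u ^ 2) _ (Finset.mem_univ 0),
      deltaOdd_zero_fourier13 hu, Finset.sum_congr rfl fun ν hν => by
        rw [deltaOdd_fourier13 (Finset.ne_of_mem_erase hν) hu, mul_pow], ← Finset.mul_sum,
      inv_zero, neg_zero]
    ring
  rw [Phi12_oddVec (fourier13_neg hu), Phi12_oddVec hu, hsum, hG]
  ring

theorem Phi12_oddVec_chirp (μ : ZMod 13) {u : ZMod 13 → ℂ} (hu : ∀ x, u (-x) = -u x) :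
    Phi12 (oddVec (chirp μ u)) = Phi12 (oddVec u) := by
  have h : ∑ ν, deltaOdd ν (chirp μ u) ^ 2 = ∑ ν, deltaOdd ν u ^ 2 := by
    rw [← Equiv.sum_comp (Equiv.addRight μ) fun ν => deltaOdd ν u ^ 2]
    simp only [deltaOdd, chirp_chirp, Equiv.coe_addRight]
  rw [Phi12_oddVec (chirp_neg _ hu), Phi12_oddVec hu, h, Gs_zero_oddVec_chirp]

/-- The terms `(-1) ^ l * q ^ ((2 * l + 1) ^ 2 / 104)` of the theta constants. -/
def thetaTerm (z : ℂ) (l : ℤ) : ℂ :=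
  (-1) ^ l * cexp (Real.pi * I * z * (2 * l + 1) ^ 2 / 52)

/-- The theta constants of order `13` as an odd function on `ZMod 13`. -/
def thetaVec (z : ℂ) (x : ZMod 13) : ℂ :=
  ∑' l : ℤ, if (l : ZMod 13) = 6 - x then thetaTerm z l else 0

theorem neg_one_zpow_eq_exp (n : ℤ) : (-1 : ℂ) ^ n = cexp (Real.pi * I * n) := by
  rw [← Complex.exp_pi_mul_I, ← Complex.exp_int_mul]
  ring_nf

theorem thetaTerm_eq_jacobiTheta₂_term (z : ℂ) (l : ℤ) :
    thetaTerm z l =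
      cexp (Real.pi * I * z / 52) * jacobiTheta₂_term l (1 / 2 + z / 26) (z / 13) := by
  rw [thetaTerm, jacobiTheta₂_term, neg_one_zpow_eq_exp, ← Complex.exp_add, ← Complex.exp_add]
  ring_nf

theorem summable_thetaTerm {z : ℂ} (hz : 0 < z.im) : Summable (thetaTerm z) := by
  have h13 : 0 < (z / 13).im := by
    rw [show (13 : ℂ) = (13 : ℝ) by norm_num, Complex.div_ofReal_im]
    positivity
  have := ((summable_jacobiTheta₂_term_iff (1 / 2 + z / 26) (z / 13)).2 h13).mul_left
    (cexp (Real.pi * I * z / 52))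
  simpa only [← thetaTerm_eq_jacobiTheta₂_term] using this

theorem thetaVec_neg (z : ℂ) (x : ZMod 13) : thetaVec z (-x) = -thetaVec z x := by
  rw [thetaVec, thetaVec, ← Equiv.tsum_eq (Equiv.subLeft (-1 : ℤ)), ← tsum_neg]
  refine tsum_congr fun l => ?_
  have h13 : (13 : ZMod 13) = 0 := rfl
  have hx : ((Equiv.subLeft (-1 : ℤ) l : ℤ) : ZMod 13) = 6 - -x ↔ (l : ZMod 13) = 6 - x := by
    rw [Equiv.subLeft_apply]
    push_cast
    constructor <;> intro h <;> linear_combination -h - h13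
  have hl : thetaTerm z (Equiv.subLeft (-1 : ℤ) l) = -thetaTerm z l := by
    rw [thetaTerm, thetaTerm, Equiv.subLeft_apply, zpow_sub₀ (by norm_num), zpow_neg_one,
      ← neg_mul]
    congr 1
    · rw [div_eq_iff (zpow_ne_zero _ (by norm_num)), neg_mul, ← mul_zpow]
      norm_num
    · push_cast
      ring_nf
  simp only [hx, hl]
  split_ifs <;> simp

theorem thetaVec_six_sub (z : ℂ) (k : ℤ) :
    thetaVec z (6 - k) = (-1) ^ k * cexp (Real.pi * I * z * (2 * k + 1) ^ 2 / 52)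
      * jacobiTheta₂ (1 / 2 + (2 * k + 1) * z / 2) (13 * z) := by
  have hinj : Function.Injective fun n : ℤ => 13 * n + k := fun a b h => by
    simp only at h
    omega
  rw [thetaVec, jacobiTheta₂, ← tsum_mul_left, ← hinj.tsum_eq]
  · refine tsum_congr fun n => ?_
    have h13 : (13 : ZMod 13) = 0 := rfl
    rw [if_pos (by push_cast; linear_combination (n : ZMod 13) * h13), thetaTerm, jacobiTheta₂_term,
      zpow_add₀ (by norm_num), zpow_mul, show (-1 : ℂ) ^ (13 : ℤ) = -1 by
        norm_num [zpow_ofNat], neg_one_zpow_eq_exp n, mul_comm _ ((-1 : ℂ) ^ k),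
      mul_assoc ((-1 : ℂ) ^ k), ← Complex.exp_add, mul_assoc ((-1 : ℂ) ^ k), ← Complex.exp_add]
    push_cast
    ring_nf
  · intro l hl
    rw [Function.mem_support, ne_eq, ite_eq_right_iff, not_forall] at hl
    obtain ⟨hl, -⟩ := hl
    rw [sub_sub_cancel, ZMod.intCast_eq_intCast_iff_dvd_sub] at hl
    obtain ⟨n, hn⟩ := hl
    exact ⟨-n, by push_cast at hn; linarith⟩

theorem thetaSum_eq_jacobiTheta₂ (c : ℤ) (z : ℂ) :
    thetaSum c z = jacobiTheta₂ (1 / 2 + c * z / 2) (13 * z) := by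
  rw [thetaSum, jacobiTheta₂]
  refine tsum_congr fun n => ?_
  rw [jacobiTheta₂_term, qp, neg_one_zpow_eq_exp, ← Complex.exp_add]
  push_cast
  ring_nf

theorem thetaSum_neg (c : ℤ) (z : ℂ) : thetaSum (-c) z = thetaSum c z := by
  rw [thetaSum_eq_jacobiTheta₂, thetaSum_eq_jacobiTheta₂, ← jacobiTheta₂_neg_left,
    ← jacobiTheta₂_add_left]
  push_cast
  ring_nf

theorem thetaVec_six_sub_eq_thetaSum (z : ℂ) (k : ℤ) :
    thetaVec z (6 - k) = (-1) ^ k * (qp ((2 * k + 1) ^ 2 / 104) z * thetaSum (2 * k + 1) z) := by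
  rw [thetaVec_six_sub, thetaSum_eq_jacobiTheta₂, qp, mul_assoc]
  push_cast
  ring_nf

theorem oddVec_thetaVec (z : ℂ) : oddVec (thetaVec z) = (-1 : ℂ) • Avec z := by
  have h (x : ZMod 13) (k c : ℤ) (hx : x = 6 - k) (hc : 2 * k + 1 = c) :
      thetaVec z x = (-1) ^ k * (qp (c ^ 2 / 104) z * thetaSum c z) := by
    rw [hx, thetaVec_six_sub_eq_thetaSum, ← hc]
    push_cast
    rfl
  have e1 := h 1 5 11 (by decide) (by norm_num)
  have e3 := h 3 3 7 (by decide) (by norm_num)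
  have e9 := h 9 (-3) (-5) (by decide) (by norm_num)
  have e8 := h 8 (-2) (-3) (by decide) (by norm_num)
  have e11 := h 11 (-5) (-9) (by decide) (by norm_num)
  have e7 := h 7 (-1) (-1) (by decide) (by norm_num)
  rw [thetaSum_neg] at e9 e8 e11 e7
  norm_num [zpow_ofNat] at e1 e3 e9 e8 e11 e7
  ext i
  fin_cases i <;> simp [oddVec, Avec, thc, *]

theorem thetaVec_add_one (z : ℂ) :
    thetaVec (z + 1) = (cexp (Real.pi * I / 52) * ZMod.stdAddChar (-5 : ZMod 13)) •
      chirp 1 (thetaVec z) := by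
  ext x
  rw [Pi.smul_apply, chirp, thetaVec, thetaVec, smul_eq_mul, ← tsum_mul_left, ← tsum_mul_left]
  refine tsum_congr fun l => ?_
  split_ifs with h
  · obtain ⟨m, hm⟩ := Int.even_mul_succ_self l
    have hx : (m : ZMod 13) = -5 + 7 * 1 * x ^ 2 := by
      have hm' : (l * (l + 1) : ZMod 13) = m + m := by exact_mod_cast congrArg Int.cast hm
      have h13 : (13 : ZMod 13) = 0 := rfl
      rw [h] at hm'
      linear_combination -7 * hm' - (m - 23 + 7 * x) * h13
    have hψ := ZMod.stdAddChar_coe (N := 13) m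
    rw [hx, AddChar.map_add_eq_mul] at hψ
    rw [← mul_assoc, mul_assoc (cexp _), hψ, thetaTerm, thetaTerm, mul_left_comm, ← Complex.exp_add,
      ← Complex.exp_add]
    have hm' : (l * (l + 1) : ℂ) = m + m := by exact_mod_cast congrArg Int.cast hm
    congr 2
    push_cast
    linear_combination (Real.pi * I / 13) * hm'
  · simp

theorem fourier13_thetaVec {z : ℂ} (hz : 0 < z.im) :
    fourier13 (thetaVec z) = (I / (-I * (z / 13)) ^ (1 / 2 : ℂ)) • thetaVec (-1 / z) := by
  have hz0 : z ≠ 0 := by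
    rintro rfl
    simp at hz
  ext x
  obtain ⟨k, rfl⟩ := ZMod.intCast_surjective x
  have h13 : (13 : ZMod 13) = 0 := rfl
  have hsum : fourier13 (thetaVec z) k = ZMod.stdAddChar (-6 * k : ZMod 13) *
      (cexp (Real.pi * I * z / 52) * jacobiTheta₂ (k / 13 + 1 / 2 + z / 26) (z / 13)) := by
    simp only [fourier13, thetaVec, jacobiTheta₂, ← tsum_mul_left]
    rw [← Summable.tsum_finsetSum]
    · refine tsum_congr fun l => ?_
      rw [Finset.sum_eq_single (6 - l : ZMod 13)]
      · rw [if_pos (by ring), show (-(k * (6 - l)) : ZMod 13) = -6 * k + (k * l : ℤ) by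
          push_cast; ring, AddChar.map_add_eq_mul, mul_assoc, thetaTerm_eq_jacobiTheta₂_term,
          ZMod.stdAddChar_coe, mul_left_comm (cexp _) (cexp _), jacobiTheta₂_term,
          jacobiTheta₂_term, ← Complex.exp_add]
        push_cast
        ring_nf
      · intro y _ hy
        rw [if_neg fun h => hy (by rw [h]; ring), mul_zero]
      · simp
    · intro y _
      refine Summable.mul_left _ ?_
      refine ((summable_thetaTerm hz).indicator {l : ℤ | (l : ZMod 13) = 6 - y}).congr fun l => ?_
      simp only [Set.indicator_apply, Set.mem_ofPred_eq]
  have hk : (k : ZMod 13) = 6 - ((-k - 7 : ℤ) : ZMod 13) := by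
    push_cast
    linear_combination -h13
  have hψ := ZMod.stdAddChar_coe (N := 13) (-6 * k)
  have hS := thetaVec_six_sub (-1 / z) (-k - 7)
  rw [← hk, neg_one_zpow_eq_exp] at hS
  rw [hsum, jacobiTheta₂_functional_equation, Pi.smul_apply, hS, smul_eq_mul]
  push_cast at hψ
  rw [hψ]
  have e1 : (k / 13 + 1 / 2 + z / 26) / (z / 13) =
    1 / 2 + (2 * ((-k - 7 : ℤ) : ℂ) + 1) * (-1 / z) / 2 := by
    push_cast
    field_simp
    ring
  have e2 : -1 / (z / 13) = 13 * (-1 / z) := by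
    field_simp
  rw [e1, e2]
  generalize (-I * (z / 13)) ^ (1 / 2 : ℂ) = s
  generalize jacobiTheta₂ _ _ = t
  have e3 : cexp (2 * Real.pi * I * (-6 * k) / 13) * (cexp (Real.pi * I * z / 52) *
      cexp (-Real.pi * I * (k / 13 + 1 / 2 + z / 26) ^ 2 / (z / 13))) = 
      cexp (Real.pi / 2 * I) * (cexp (Real.pi * I * ((-k - 7 : ℤ) : ℂ)) *
      cexp (Real.pi * I * (-1 / z) * (2 * ((-k - 7 : ℤ) : ℂ) + 1) ^ 2 / 52)) := by
    simp only [← Complex.exp_add]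
    refine Complex.exp_eq_exp_iff_exists_int.2 ⟨3, ?_⟩
    push_cast
    field_simp
    ring
  rw [Complex.exp_pi_div_two_mul_I] at e3
  push_cast at e3 ⊢
  linear_combination (t / s) * e3

theorem Phi12_smul (c : ℂ) (v : Fin 6 → ℂ) : Phi12 (c • v) = c ^ 12 * Phi12 v := by
  have hD (j : ℕ) : D j (c • v) = c ^ 3 * D j v := by
    unfold D
    split <;> (try simp only [Pi.smul_apply, smul_eq_mul]) <;> ring
  have hDinf : Dinf (c • v) = c ^ 3 * Dinf v := by
    simp only [Dinf, Pi.smul_apply, smul_eq_mul]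
    ring
  have hG (j : ℕ) : Gs j (c • v) = c ^ 6 * Gs j v := by
    unfold Gs
    split <;> (try simp only [hD, hDinf]) <;> ring
  have hδ (n : ℕ) : deltaF n (c • v) = c ^ 6 * deltaF n v := by
    simp only [deltaF, hG, mul_add, Finset.mul_sum]
    congr 1
    · ring
    · exact Finset.sum_congr rfl fun j _ => by ring
  simp only [Phi12, deltaInf, hG, hδ, mul_pow, ← Finset.mul_sum]
  ring

theorem Phi12_oddVec_thetaVec_neg_inv {z : ℂ} (hz : 0 < z.im) :
    Phi12 (oddVec (thetaVec (-1 / z))) = -z ^ 6 * Phi12 (oddVec (thetaVec z)) := by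
  have hz0 : z ≠ 0 := by
    rintro rfl
    simp at hz
  have h := Phi12_oddVec_fourier13 (thetaVec_neg z)
  rw [fourier13_thetaVec hz, oddVec_smul, Phi12_smul, div_pow] at h
  have hs := Complex.cpow_nat_inv_pow (-I * (z / 13)) two_ne_zero
  rw [show ((2 : ℕ) : ℂ)⁻¹ = 1 / 2 by norm_num] at hs
  rw [show ((-I * (z / 13)) ^ (1 / 2 : ℂ)) ^ 12 = -(z / 13) ^ 6 by
    rw [pow_mul _ 2 6, hs, mul_pow, neg_pow, pow_mul I 2 3, I_sq]
    ring, show I ^ 12 = 1 by rw [pow_mul I 4 3, I_pow_four, one_pow]] at h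
  generalize -1 / z = w at h ⊢
  field_simp at h
  linear_combination -h

theorem Phi12_oddVec_thetaVec_add_one (z : ℂ) :
    Phi12 (oddVec (thetaVec (z + 1))) = -Phi12 (oddVec (thetaVec z)) := by
  rw [thetaVec_add_one, oddVec_smul, Phi12_smul, Phi12_oddVec_chirp _ (thetaVec_neg z)]
  have h5 : (-5 : ZMod 13) = (8 : ℕ) := by decide
  rw [h5, stdAddChar_natCast, mul_pow, ← pow_mul, show 8 * 12 = 13 * 7 + 5 from rfl, pow_add,
    pow_mul, zeta13_pow, one_pow, one_mul, zeta13, ← Complex.exp_nat_mul, ← Complex.exp_nat_mul,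
    ← Complex.exp_add, show ((12 : ℕ) : ℂ) * (Real.pi * I / 52) + ((5 : ℕ) : ℂ) *
      (2 * Real.pi * I / 13) = Real.pi * I by push_cast; ring, Complex.exp_pi_mul_I, neg_one_mul]

open UpperHalfPlane in
/-- A holomorphic function on the upper half-plane that is invariant under the modular group and
tends to a limit at the cusp is constant. -/
theorem eq_of_modular_invariant {f : ℂ → ℂ} {c : ℂ}
    (hf : ∀ z : ℂ, 0 < z.im → DifferentiableAt ℂ f z)
    (hT : ∀ z : ℂ, 0 < z.im → f (z + 1) = f z) (hS : ∀ z : ℂ, 0 < z.im → f (-1 / z) = f z)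
    (hlim : Filter.Tendsto (fun z : ℍ => f z) atImInfty (nhds c)) {z : ℂ} (hz : 0 < z.im) :
    f z = c := by
  let g : ℍ → ℂ := fun z => f z
  have gS : SlashAction.map (0 : ℤ) ModularGroup.S g = g := by
    ext w
    rw [ModularForm.SL_slash_apply, UpperHalfPlane.modular_S_smul]
    simpa [g, neg_div] using hS w w.2
  have gT : SlashAction.map (0 : ℤ) ModularGroup.T g = g := by
    ext w
    rw [ModularForm.SL_slash_apply, UpperHalfPlane.modular_T_smul]
    simpa [g, add_comm] using hT w w.2
  have gSL := SlashInvariantForm.slash_action_generators_SL2Z gS gT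
  let F : ModularForm
      (Matrix.SpecialLinearGroup.mapGL ℝ : Matrix.SpecialLinearGroup (Fin 2) ℤ →* _).range 0 :=
    { toFun := g
      slash_action_eq' := by
        rintro _ ⟨A, rfl⟩
        exact gSL A
      holo' := by
        rw [UpperHalfPlane.mdifferentiable_iff]
        refine DifferentiableOn.congr (fun z hz => (hf z hz).differentiableWithinAt) fun z hz => ?_
        simp [g, ofComplex_apply_of_im_pos hz]
      bdd_at_cusps' := by
        intro c hc
        rw [Subgroup.IsArithmetic.isCusp_iff_isCusp_SL2Z] at hc
        rw [OnePoint.isBoundedAt_iff_forall_SL2Z hc]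
        intro γ _
        rw [gSL]
        exact hlim.isBigO_one ℝ }
  obtain ⟨d, hd⟩ := ModularFormClass.levelOne_weight_zero_const F
  have hg (w : ℍ) : g w = d := congrFun hd w
  have hdc : d = c := by
    refine tendsto_nhds_unique (tendsto_const_nhds (f := atImInfty)) (hlim.congr fun w => ?_)
    exact hg w
  exact (hg ⟨z, hz⟩).trans hdc

theorem etaF_eq_eta : etaF = ModularForm.eta := by
  ext z
  simp only [etaF, ModularForm.eta, ModularForm.eta_q_eq_pow, qp, Function.Periodic.qParam]
  push_cast
  congr 2
  ring

theorem etaF_add_one_pow (z : ℂ) : etaF (z + 1) ^ 12 = -etaF z ^ 12 := by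
  have h : cexp (2 * Real.pi * I * (z + 1)) = cexp (2 * Real.pi * I * z) := by
    rw [mul_add, mul_one, Complex.exp_add, Complex.exp_two_pi_mul_I, mul_one]
  have hq : qp (1 / 24) (z + 1) ^ 12 = -qp (1 / 24) z ^ 12 := by
    simp only [qp]
    rw [← Complex.exp_nat_mul, ← Complex.exp_nat_mul, ← mul_neg_one, ← Complex.exp_pi_mul_I,
      ← Complex.exp_add]
    push_cast
    ring_nf
  rw [etaF, etaF, h, mul_pow, hq, mul_pow, neg_mul]

theorem etaF_neg_inv_pow {z : ℂ} (hz : 0 < z.im) : etaF (-1 / z) ^ 12 = -z ^ 6 * etaF z ^ 12 := by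
  have h := ModularForm.eta_comp_eq_csqrt_I_inv hz
  have hz0 : z ≠ 0 := by
    rintro rfl
    simp at hz
  have hsqrt {w : ℂ} (hw : w ≠ 0) : Complex.sqrt w ^ 12 = w ^ 6 := by
    rw [sqrt_eq_exp hw, ← Complex.exp_nat_mul]
    nth_rw 2 [← Complex.exp_log hw]
    rw [← Complex.exp_nat_mul]
    push_cast
    ring_nf
  simp only [Function.comp_apply, Pi.smul_apply, Pi.mul_apply, smul_eq_mul] at h
  rw [etaF_eq_eta, h, mul_pow, mul_pow, inv_pow, hsqrt I_ne_zero, hsqrt hz0, pow_mul I 2 3, I_sq]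
  ring

theorem differentiableAt_etaF {z : ℂ} (hz : 0 < z.im) : DifferentiableAt ℂ etaF z := by
  rw [etaF_eq_eta]
  exact ModularForm.differentiableAt_eta_of_mem_upperHalfPlaneSet hz

theorem etaF_ne_zero {z : ℂ} (hz : 0 < z.im) : etaF z ≠ 0 := by
  rw [etaF_eq_eta]
  exact ModularForm.eta_ne_zero hz

theorem differentiableAt_thetaSum (c : ℤ) {z : ℂ} (hz : 0 < z.im) :
    DifferentiableAt ℂ (thetaSum c) z := by
  have h13 : 0 < (13 * z).im := by
    simpa using hz
  have h := (hasFDerivAt_jacobiTheta₂ (1 / 2 + c * z / 2) h13).differentiableAt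
  have := DifferentiableAt.comp (f := fun z : ℂ => (1 / 2 + c * z / 2, 13 * z)) z h (by fun_prop)
  exact this.congr_of_eventuallyEq
    (Filter.Eventually.of_forall fun w => thetaSum_eq_jacobiTheta₂ c w)

theorem differentiableAt_qp (α : ℚ) (z : ℂ) : DifferentiableAt ℂ (qp α) z := by
  unfold qp
  fun_prop

theorem differentiableAt_Avec {z : ℂ} (hz : 0 < z.im) : DifferentiableAt ℂ Avec z := by
  rw [differentiableAt_pi]
  intro i
  have h (α : ℚ) (c : ℤ) : DifferentiableAt ℂ (fun z => qp α z * thetaSum c z) z :=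
    (differentiableAt_qp α z).mul (differentiableAt_thetaSum c hz)
  fin_cases i
  · exact h _ _
  · exact h _ _
  · exact h _ _
  · exact (h _ _).neg
  · exact h _ _
  · exact h _ _

theorem differentiable_Phi12 : Differentiable ℂ Phi12 := by
  have hD (j : ℕ) : Differentiable ℂ (D j) := by
    obtain hj | ⟨n, rfl⟩ : j < 13 ∨ ∃ n, j = n + 13 :=
      (lt_or_ge j 13).imp_right fun h => ⟨j - 13, by omega⟩
    · interval_cases j <;> unfold D <;> fun_prop
    · exact differentiable_const 0
  have hDinf : Differentiable ℂ Dinf := by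
    unfold Dinf
    fun_prop
  have hG (j : ℕ) : Differentiable ℂ (Gs j) := by
    obtain hj | ⟨n, rfl⟩ : j < 13 ∨ ∃ n, j = n + 13 :=
      (lt_or_ge j 13).imp_right fun h => ⟨j - 13, by omega⟩
    · interval_cases j <;> unfold Gs <;> fun_prop
    · exact differentiable_const 0
  have hδ (n : ℕ) : Differentiable ℂ (deltaF n) := by
    unfold deltaF
    fun_prop
  unfold Phi12 deltaInf
  fun_prop

open UpperHalfPlane in
theorem tendsto_prod_one_sub_pow :
    Filter.Tendsto (fun z : ℍ =>
      (∏' n : ℕ, (1 - cexp (2 * Real.pi * Complex.I * z) ^ (n + 1))) ^ 12) atImInfty (nhds 1) := by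
  have htprod : Filter.Tendsto (fun q : ℂ => ∏' n : ℕ, (1 - q ^ (n + 1))) (nhds 0) (nhds 1) := by
    have := tendsto_tprod_one_add_of_dominated_convergence (𝓕 := nhds 0) (g := 0)
      (f := fun (q : ℂ) (n : ℕ) => -q ^ (n + 1)) (bound := fun n => (1 / 2 : ℝ) ^ (n + 1))
    simp only [Pi.zero_apply, norm_neg, norm_pow, add_zero, tprod_one] at this
    simp_rw [sub_eq_add_neg]
    refine this
      (by simpa only [pow_succ'] using (summable_geometric_of_abs_lt_one (by norm_num)).mul_left _)
      (fun k => by simpa using ((continuous_pow (M := ℂ) (k + 1)).tendsto 0).neg) ?_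
    filter_upwards [Metric.ball_mem_nhds (0 : ℂ) (by norm_num : (0 : ℝ) < 1 / 2)] with q hq k
    exact pow_le_pow_left₀ (norm_nonneg _) (mem_ball_zero_iff.mp hq).le _
  have := (htprod.comp (qParam_tendsto_atImInfty zero_lt_one)).pow 12
  simpa only [Function.Periodic.qParam, Complex.ofReal_one, div_one, Function.comp_def,
    one_pow] using this

/-- The exponents of the leading powers of `q ^ (1 / 104)` in the theta constants. -/
def thetaExp : Fin 6 → ℕ := ![121, 49, 25, 9, 81, 1]

/-- The cubic form `D j` after scaling the variables by powers of `t`, where `s = t ^ 104`. -/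
def scaledD : ℕ → (Fin 6 → ℂ) → ℂ → ℂ
  | 0, v, s => v 0 * v 1 * v 2 * s
  | 1, v, s => 2 * v 1 * v 2 ^ 2 + v 1 ^ 2 * v 5 - v 3 ^ 2 * v 4 + v 0 * v 4 * v 5 * s
  | 2, v, s => -v 5 ^ 3 + v 1 ^ 2 * v 3 * s - 2 * v 1 * v 4 ^ 2 * s ^ 2
      + v 0 * v 3 * v 4 * s ^ 2 + 3 * v 2 * v 4 * v 5 * s
  | 3, v, s => 2 * v 0 * v 1 ^ 2 * s ^ 2 + v 0 ^ 2 * v 4 * s ^ 3 - v 3 * v 5 ^ 2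
      + v 2 * v 3 * v 4 * s
  | 4, v, s => -v 1 ^ 2 * v 2 * s + v 0 * v 5 ^ 2 * s - 2 * v 3 ^ 2 * v 5
      - v 0 * v 2 * v 4 * s ^ 2
  | 5, v, s => -v 3 ^ 3 + v 2 ^ 2 * v 4 * s - 2 * v 2 * v 5 ^ 2 + v 1 * v 4 * v 5 * s
      + 3 * v 0 * v 3 * v 5 * s
  | 6, v, s => -v 4 ^ 3 * s ^ 2 + v 0 ^ 2 * v 5 * s ^ 2 - 2 * v 0 * v 3 ^ 2 * s
      + v 2 * v 3 * v 5 + 3 * v 1 * v 3 * v 4 * s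
  | 7, v, s => -v 1 ^ 3 * s + v 2 * v 3 ^ 2 - v 0 * v 2 * v 5 * s - 3 * v 0 * v 1 * v 4 * s ^ 2
      + 2 * v 0 ^ 2 * v 3 * s ^ 2
  | 8, v, s => -v 0 ^ 3 * s ^ 3 + v 1 * v 5 ^ 2 - v 1 * v 2 * v 4 * s - 3 * v 0 * v 2 * v 3 * s
      + 2 * v 2 ^ 2 * v 5
  | 9, v, s => 2 * v 0 ^ 2 * v 2 * s ^ 2 + v 2 ^ 2 * v 3 - v 4 ^ 2 * v 5 * s + v 1 * v 3 * v 5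
  | 10, v, s => -v 0 * v 2 ^ 2 * s + v 1 * v 3 ^ 2 - 2 * v 3 * v 4 ^ 2 * s - v 0 * v 1 * v 5 * s
  | 11, v, s => -v 2 ^ 3 + v 0 * v 4 ^ 2 * s ^ 2 - v 0 * v 1 * v 3 * s - 3 * v 1 * v 2 * v 5
      + 2 * v 1 ^ 2 * v 4 * s
  | 12, v, s => -v 0 ^ 2 * v 1 * s ^ 2 + v 2 * v 4 ^ 2 * s - 2 * v 4 * v 5 ^ 2 - v 1 * v 2 * v 3
  | _, _, _ => 0

/-- The sextic form `Gs j` after scaling the variables by powers of `t`, where `s = t ^ 104`. -/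
def scaledG : ℕ → (Fin 6 → ℂ) → ℂ → ℂ
  | 0, v, s => scaledD 0 v s ^ 2 + Dinf v ^ 2
  | 1, v, s => -scaledD 7 v s ^ 2 + 2 * scaledD 0 v s * scaledD 1 v s * s
      + 10 * Dinf v * scaledD 1 v s * s + 2 * scaledD 2 v s * scaledD 12 v s
      - 2 * scaledD 3 v s * scaledD 11 v s - 4 * scaledD 4 v s * scaledD 10 v s
      - 2 * scaledD 9 v s * scaledD 5 v s
  | 2, v, s => -2 * scaledD 1 v s ^ 2 * s - 4 * scaledD 0 v s * scaledD 2 v s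
      + 6 * Dinf v * scaledD 2 v s - 2 * scaledD 4 v s * scaledD 11 v s
      + 2 * scaledD 5 v s * scaledD 10 v s - 2 * scaledD 6 v s * scaledD 9 v s
      - 2 * scaledD 7 v s * scaledD 8 v s
  | 3, v, s => -scaledD 8 v s ^ 2 + 2 * scaledD 0 v s * scaledD 3 v s
      + 10 * Dinf v * scaledD 3 v s + 2 * scaledD 6 v s * scaledD 10 v s
      - 2 * scaledD 9 v s * scaledD 7 v s - 4 * scaledD 12 v s * scaledD 4 v s
      - 2 * scaledD 1 v s * scaledD 2 v s
  | 4, v, s => -scaledD 2 v s ^ 2 + 10 * scaledD 0 v s * scaledD 4 v s * s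
      - 2 * Dinf v * scaledD 4 v s * s + 2 * scaledD 5 v s * scaledD 12 v s * s
      - 2 * scaledD 9 v s * scaledD 8 v s * s - 4 * scaledD 1 v s * scaledD 3 v s * s
      - 2 * scaledD 10 v s * scaledD 7 v s * s
  | 5, v, s => -2 * scaledD 9 v s ^ 2 * s - 4 * scaledD 0 v s * scaledD 5 v s * s
      + 6 * Dinf v * scaledD 5 v s * s - 2 * scaledD 10 v s * scaledD 8 v s * s
      + 2 * scaledD 6 v s * scaledD 12 v s * s - 2 * scaledD 2 v s * scaledD 3 v s
      - 2 * scaledD 11 v s * scaledD 7 v s * s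
  | 6, v, s => -2 * scaledD 3 v s ^ 2 - 4 * scaledD 0 v s * scaledD 6 v s * s
      + 6 * Dinf v * scaledD 6 v s * s - 2 * scaledD 12 v s * scaledD 7 v s * s
      + 2 * scaledD 2 v s * scaledD 4 v s - 2 * scaledD 5 v s * scaledD 1 v s * s
      - 2 * scaledD 8 v s * scaledD 11 v s * s
  | 7, v, s => -2 * scaledD 10 v s ^ 2 * s + 6 * scaledD 0 v s * scaledD 7 v s * s
      + 4 * Dinf v * scaledD 7 v s * s - 2 * scaledD 1 v s * scaledD 6 v s * s
      - 2 * scaledD 2 v s * scaledD 5 v s - 2 * scaledD 8 v s * scaledD 12 v s * s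
      - 2 * scaledD 9 v s * scaledD 11 v s * s
  | 8, v, s => -2 * scaledD 4 v s ^ 2 + 6 * scaledD 0 v s * scaledD 8 v s * s
      + 4 * Dinf v * scaledD 8 v s * s - 2 * scaledD 3 v s * scaledD 5 v s
      - 2 * scaledD 6 v s * scaledD 2 v s - 2 * scaledD 11 v s * scaledD 10 v s * s
      - 2 * scaledD 1 v s * scaledD 7 v s * s
  | 9, v, s => -scaledD 11 v s ^ 2 * s + 2 * scaledD 0 v s * scaledD 9 v s * s
      + 10 * Dinf v * scaledD 9 v s * s + 2 * scaledD 5 v s * scaledD 4 v s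
      - 2 * scaledD 1 v s * scaledD 8 v s * s - 4 * scaledD 10 v s * scaledD 12 v s * s
      - 2 * scaledD 3 v s * scaledD 6 v s
  | 10, v, s => -scaledD 5 v s ^ 2 + 10 * scaledD 0 v s * scaledD 10 v s * s
      - 2 * Dinf v * scaledD 10 v s * s + 2 * scaledD 6 v s * scaledD 4 v s
      - 2 * scaledD 3 v s * scaledD 7 v s - 4 * scaledD 9 v s * scaledD 1 v s * s
      - 2 * scaledD 12 v s * scaledD 11 v s * s
  | 11, v, s => -2 * scaledD 12 v s ^ 2 * s + 6 * scaledD 0 v s * scaledD 11 v s * s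
      + 4 * Dinf v * scaledD 11 v s * s - 2 * scaledD 9 v s * scaledD 2 v s
      - 2 * scaledD 5 v s * scaledD 6 v s - 2 * scaledD 7 v s * scaledD 4 v s
      - 2 * scaledD 3 v s * scaledD 8 v s
  | 12, v, s => -scaledD 6 v s ^ 2 + 10 * scaledD 0 v s * scaledD 12 v s * s
      - 2 * Dinf v * scaledD 12 v s * s + 2 * scaledD 2 v s * scaledD 10 v s
      - 2 * scaledD 1 v s * scaledD 11 v s * s - 4 * scaledD 3 v s * scaledD 9 v s
      - 2 * scaledD 4 v s * scaledD 8 v s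
  | _, _, _ => 0

/-- The form `Phi12` after scaling the variables by powers of `t`, where `s = t ^ 104`. -/
def scaledPhi12 (v : Fin 6 → ℂ) (s : ℂ) : ℂ :=
  -(1 / 26) * (1183 * s ^ 3 * scaledG 0 v s ^ 2 + s * scaledG 1 v s * scaledG 12 v s
    + s * scaledG 2 v s * scaledG 11 v s + s * scaledG 3 v s * scaledG 10 v s
    + scaledG 4 v s * scaledG 9 v s + scaledG 5 v s * scaledG 8 v s
    + scaledG 6 v s * scaledG 7 v s)

theorem D_scale (t : ℂ) (v : Fin 6 → ℂ) {j : ℕ} (hj : j < 13) :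
    D j (fun i => t ^ thetaExp i * v i) = t ^ ((8 * j + 91) % 104) * scaledD j v (t ^ 104) := by
  interval_cases j <;>
    simp only [D, scaledD, thetaExp, Matrix.cons_val, Nat.reduceMul, Nat.reduceAdd,
      Nat.reduceMod] <;>
    ring

theorem Dinf_scale (t : ℂ) (v : Fin 6 → ℂ) :
    Dinf (fun i => t ^ thetaExp i * v i) = t ^ 91 * Dinf v := by
  simp only [Dinf, thetaExp, Matrix.cons_val]
  ring

theorem Gs_zero_scale (t : ℂ) (v : Fin 6 → ℂ) :
    Gs 0 (fun i => t ^ thetaExp i * v i) = t ^ 182 * scaledG 0 v (t ^ 104) := by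
  simp only [Gs, scaledG, D_scale, Dinf_scale, Nat.reduceMul, Nat.reduceAdd, Nat.reduceMod,
    Nat.reduceLT]
  ring

theorem Gs_scale (t : ℂ) (v : Fin 6 → ℂ) {j : ℕ} (hj : j < 13) (hj0 : j ≠ 0) :
    Gs j (fun i => t ^ thetaExp i * v i) = t ^ ((8 * j + 78) % 104) * scaledG j v (t ^ 104) := by
  interval_cases j
  · exact absurd rfl hj0
  all_goals
    simp only [Gs, scaledG, D_scale, Dinf_scale, Nat.reduceMul, Nat.reduceAdd, Nat.reduceMod,
      Nat.reduceLT]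
    ring

theorem sum_zeta13_pow_mul (n : ℕ) :
    ∑ ν ∈ Finset.range 13, zeta13 ^ (n * ν) = if 13 ∣ n then 13 else 0 := by
  simp only [pow_mul]
  split_ifs with h
  · obtain ⟨m, rfl⟩ := h
    simp [pow_mul, zeta13_pow]
  · have h1 : zeta13 ^ n ≠ 1 := by
      rw [← stdAddChar_natCast, ← AddChar.map_zero_eq_one (ZMod.stdAddChar (N := 13))]
      exact fun h' => h ((ZMod.natCast_eq_zero_iff n 13).1 (ZMod.injective_stdAddChar h'))
    rw [geom_sum_eq h1, ← pow_mul, mul_comm, pow_mul, zeta13_pow, one_pow, sub_self, zero_div]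

theorem sum_sq_zeta13 (g : ℕ → ℂ) :
    ∑ ν ∈ Finset.range 13, (∑ j ∈ Finset.range 13, zeta13 ^ (j * ν) * g j) ^ 2
      = 13 * ∑ j ∈ Finset.range 13, g j * g ((13 - j) % 13) := by
  have h (ν : ℕ) : (∑ j ∈ Finset.range 13, zeta13 ^ (j * ν) * g j) ^ 2
      = ∑ j ∈ Finset.range 13, ∑ k ∈ Finset.range 13, g j * g k * zeta13 ^ ((j + k) * ν) := by
    rw [sq, Finset.sum_mul_sum]
    refine Finset.sum_congr rfl fun j _ => Finset.sum_congr rfl fun k _ => ?_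
    ring
  simp only [h]
  rw [Finset.sum_comm, Finset.mul_sum]
  refine Finset.sum_congr rfl fun j hj => ?_
  rw [Finset.sum_comm]
  simp only [← Finset.mul_sum, sum_zeta13_pow_mul]
  rw [Finset.sum_eq_single ((13 - j) % 13)]
  · rw [if_pos (by rw [Finset.mem_range] at hj; omega)]
    ring
  · intro k hk hkj
    rw [if_neg (by rw [Finset.mem_range] at hj hk; omega), mul_zero]
  · intro h
    exact absurd (Finset.mem_range.2 (Nat.mod_lt _ (by norm_num))) h

theorem Phi12_eq_products (v : Fin 6 → ℂ) : Phi12 v = -(1 / 26) * (1183 * Gs 0 v ^ 2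
    + Gs 1 v * Gs 12 v + Gs 2 v * Gs 11 v + Gs 3 v * Gs 10 v + Gs 4 v * Gs 9 v
    + Gs 5 v * Gs 8 v + Gs 6 v * Gs 7 v) := by
  have h (ν : ℕ) : deltaF ν v = ∑ j ∈ Finset.range 13,
      zeta13 ^ (j * ν) * if j = 0 then -13 * Gs 0 v else Gs j v := by
    rw [deltaF, Finset.range_eq_Ico, Finset.sum_eq_sum_Ico_succ_bot (by norm_num)]
    simp only [zero_mul, pow_zero, one_mul, if_true]
    refine congrArg _ (Finset.sum_congr rfl fun j hj => ?_)
    rw [if_neg (by have := (Finset.mem_Icc.1 hj).1; omega)]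
  rw [Phi12, deltaInf]
  simp only [h, sum_sq_zeta13]
  simp only [Finset.sum_range_succ, Finset.sum_range_zero, Nat.reduceSub,
    Nat.reduceMod, OfNat.ofNat_ne_zero, one_ne_zero, if_true, if_false]
  ring

theorem Phi12_scale (t : ℂ) (v : Fin 6 → ℂ) :
    Phi12 (fun i => t ^ thetaExp i * v i) = t ^ 52 * scaledPhi12 v (t ^ 104) := by
  rw [Phi12_eq_products, scaledPhi12, Gs_zero_scale]
  simp only [Gs_scale, Nat.reduceMul, Nat.reduceAdd, Nat.reduceMod, Nat.reduceLT, ne_eq,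
    OfNat.ofNat_ne_zero, one_ne_zero, not_false_eq_true]
  ring

theorem scaledPhi12_leading : scaledPhi12 ![1, 1, 1, -1, 1, 1] 0 = 1 := by
  simp [scaledPhi12, scaledG, scaledD, Dinf]
  norm_num

theorem continuous_scaledPhi12 :
    Continuous fun p : (Fin 6 → ℂ) × ℂ => scaledPhi12 p.1 p.2 := by
  have hD (j : ℕ) : Continuous fun p : (Fin 6 → ℂ) × ℂ => scaledD j p.1 p.2 := by
    obtain hj | ⟨n, rfl⟩ : j < 13 ∨ ∃ n, j = n + 13 :=
      (lt_or_ge j 13).imp_right fun h => ⟨j - 13, by omega⟩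
    · interval_cases j <;> unfold scaledD <;> fun_prop
    · exact continuous_const
  have hDinf : Continuous fun p : (Fin 6 → ℂ) × ℂ => Dinf p.1 := by
    unfold Dinf
    fun_prop
  have hG (j : ℕ) : Continuous fun p : (Fin 6 → ℂ) × ℂ => scaledG j p.1 p.2 := by
    obtain hj | ⟨n, rfl⟩ : j < 13 ∨ ∃ n, j = n + 13 :=
      (lt_or_ge j 13).imp_right fun h => ⟨j - 13, by omega⟩
    · interval_cases j <;> unfold scaledG <;> fun_prop
    · exact continuous_const
  unfold scaledPhi12
  fun_prop

open UpperHalfPlane in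
theorem tendsto_thetaSum {c : ℤ} (hc : |c| ≤ 11) :
    Filter.Tendsto (fun z : ℍ => thetaSum c z) atImInfty (nhds 1) := by
  have hnorm (n : ℤ) (z : ℍ) :
      ‖(-1 : ℂ) ^ n * qp ((13 * (n : ℚ) ^ 2 + (c : ℚ) * (n : ℚ)) / 2) z‖
        = Real.exp (-(Real.pi * ((13 * n ^ 2 + c * n : ℤ) : ℝ) * z.im)) := by
    rw [norm_mul, norm_zpow, norm_neg, norm_one, one_zpow, one_mul, qp, Complex.norm_exp]
    congr 1
    rw [show 2 * Real.pi * Complex.I * (((13 * (n : ℚ) ^ 2 + (c : ℚ) * (n : ℚ)) / 2 : ℚ) : ℂ) * z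
      = ((Real.pi * ((13 * n ^ 2 + c * n : ℤ) : ℝ) : ℝ) : ℂ) * (z * Complex.I) by push_cast; ring,
      Complex.re_ofReal_mul, Complex.mul_I_re, UpperHalfPlane.coe_im]
    ring
  have hexp (n : ℤ) : 2 * n ^ 2 ≤ 13 * n ^ 2 + c * n := by
    have h1 : |c * n| ≤ 11 * n ^ 2 := by
      rw [abs_mul]
      refine mul_le_mul hc ?_ (abs_nonneg n) (by norm_num)
      rw [← sq_abs]
      exact Int.le_self_sq _
    linarith [neg_abs_le (c * n)]
  have hone : ∑' n : ℤ, (if n = 0 then (1 : ℂ) else 0) = 1 := tsum_ite_eq 0 1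
  rw [← hone]
  refine tendsto_tsum_of_dominated_convergence
    (bound := fun n => ‖jacobiTheta₂_term n 0 (2 * Complex.I)‖) ?_ (fun n => ?_) ?_
  · exact ((summable_jacobiTheta₂_term_iff 0 (2 * Complex.I)).2 (by simp)).norm
  · split_ifs with hn
    · simp [hn, qp]
    · rw [tendsto_zero_iff_norm_tendsto_zero]
      simp only [hnorm]
      refine Real.tendsto_exp_neg_atTop_nhds_zero.comp
        (Filter.Tendsto.const_mul_atTop (mul_pos Real.pi_pos ?_) Filter.tendsto_comap)
      have : 0 < n ^ 2 := by positivity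
      exact_mod_cast (by linarith [hexp n] : 0 < 13 * n ^ 2 + c * n)
  · filter_upwards [(atImInfty_mem _).2 ⟨1, fun z hz => hz⟩] with z (hz : 1 ≤ z.im) n
    rw [hnorm, norm_jacobiTheta₂_term, Real.exp_le_exp]
    have h2 : (2 * n ^ 2 : ℝ) ≤ ((13 * n ^ 2 + c * n : ℤ) : ℝ) := by exact_mod_cast hexp n
    have h3 : (2 * n ^ 2 : ℝ) ≤ ((13 * n ^ 2 + c * n : ℤ) : ℝ) * z.im :=
      h2.trans (le_mul_of_one_le_right ((by positivity : (0 : ℝ) ≤ 2 * n ^ 2).trans h2) hz)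
    have h4 := mul_le_mul_of_nonneg_left h3 Real.pi_pos.le
    simp only [Complex.mul_im, Complex.re_ofNat, Complex.im_ofNat, Complex.I_im, Complex.I_re,
      Complex.zero_im]
    linarith

/-- The theta constants of order `13` with their leading powers of `q` removed. -/
def thetaUnit (z : ℂ) : Fin 6 → ℂ :=
  ![thetaSum 11 z, thetaSum 7 z, thetaSum 5 z, -thetaSum 3 z, thetaSum 9 z, thetaSum 1 z]

theorem qp_natCast_div (k : ℕ) (z : ℂ) : qp (k / 104) z = qp (1 / 104) z ^ k := by
  rw [qp, qp, ← Complex.exp_nat_mul]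
  push_cast
  ring_nf

theorem Avec_eq_scale (z : ℂ) :
    Avec z = fun i => qp (1 / 104) z ^ thetaExp i * thetaUnit z i := by
  ext i
  simp only [← qp_natCast_div]
  fin_cases i <;> simp [Avec, thc, thetaExp, thetaUnit]

open UpperHalfPlane in
theorem tendsto_thetaUnit :
    Filter.Tendsto (fun z : ℍ => thetaUnit z) atImInfty (nhds ![1, 1, 1, -1, 1, 1]) := by
  rw [tendsto_pi_nhds]
  intro i
  fin_cases i
  · exact tendsto_thetaSum (by norm_num)
  · exact tendsto_thetaSum (by norm_num)
  · exact tendsto_thetaSum (by norm_num)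
  · exact (tendsto_thetaSum (by norm_num)).neg
  · exact tendsto_thetaSum (by norm_num)
  · exact tendsto_thetaSum (by norm_num)

open UpperHalfPlane in
theorem tendsto_Phi12_div_etaF_pow :
    Filter.Tendsto (fun z : ℍ => Phi12 (Avec z) / etaF z ^ 12) atImInfty (nhds 1) := by
  have hq : Filter.Tendsto (fun z : ℍ => qp (1 / 104) z ^ 104) atImInfty (nhds 0) := by
    refine (qParam_tendsto_atImInfty zero_lt_one).congr fun z => ?_
    rw [← qp_natCast_div, Function.Periodic.qParam, qp]
    norm_num
  have h := ((continuous_scaledPhi12.tendsto _).comp (tendsto_thetaUnit.prodMk_nhds hq)).div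
    tendsto_prod_one_sub_pow one_ne_zero
  simp only [scaledPhi12_leading, div_one] at h
  refine h.congr fun z => ?_
  have ht : qp (1 / 24) z ^ 12 = qp (1 / 104) z ^ 52 := by
    rw [qp, qp, ← Complex.exp_nat_mul, ← Complex.exp_nat_mul]
    push_cast
    ring_nf
  rw [Avec_eq_scale, Phi12_scale, etaF, mul_pow, ht,
    mul_div_mul_left _ _ (pow_ne_zero _ (by exact Complex.exp_ne_zero _))]
  rfl

theorem Phi12_Avec_eq_Phi12_thetaVec (z : ℂ) : Phi12 (Avec z) = Phi12 (oddVec (thetaVec z)) := by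
  rw [oddVec_thetaVec, Phi12_smul]
  norm_num

theorem Phi12_Avec {z : ℂ} (hz : 0 < z.im) : Phi12 (Avec z) = etaF z ^ 12 := by
  have h := eq_of_modular_invariant (f := fun z => Phi12 (Avec z) / etaF z ^ 12)
    (fun z hz => ((differentiable_Phi12 _).comp z (differentiableAt_Avec hz)).div
      ((differentiableAt_etaF hz).pow 12) (pow_ne_zero _ (etaF_ne_zero hz)))
    (fun z _ => by
      simp only [Phi12_Avec_eq_Phi12_thetaVec, Phi12_oddVec_thetaVec_add_one, etaF_add_one_pow,
        neg_div_neg_eq])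
    (fun z hz => by
      have hz0 : z ≠ 0 := by
        rintro rfl
        simp at hz
      simp only [Phi12_Avec_eq_Phi12_thetaVec, Phi12_oddVec_thetaVec_neg_inv hz,
        etaF_neg_inv_pow hz]
      rw [mul_div_mul_left _ _ (neg_ne_zero.2 (pow_ne_zero 6 hz0))])
    tendsto_Phi12_div_etaF_pow hz
  rwa [div_eq_one_iff_eq (pow_ne_zero _ (etaF_ne_zero hz))] at h

/-- `Φ12(x1(z),…,x6(z)) = Δ(z)` on ℍ. -/
theorem stmt_13 (z : ℂ) (hz : 0 < z.im) : Phi12 (X z) = Delta z := by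
  rw [show X z = etaF z • Avec z from rfl, Phi12_smul, Phi12_Avec hz, Delta]
  ring

end
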